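/- arXiv:1308.4341 — 2 statements merged into one kernel-verified Lean document; each statement's English description precedes it below -/
import Mathlib

section
/- Let k ≥ 1, n ≥ 7k², and let G be a simple graph of order n. If q(G) ≥ q(S_{n,k}), then G contains a path on 2k+2 vertices as a subgraph, unless G is isomorphic to S_{n,k}. -/
open Matrix BigOperators

noncomputable def edgeCount {V : Type*} (G : SimpleGraph V) : ℕ := Nat.card G.edgeSet

noncomputable def deg {V : Type*} (G : SimpleGraph V) (v : V) : ℕ := Nat.card (G.neighborSet v)

def HasPathOn {V : Type*} (G : SimpleGraph V) (l : ℕ) : Prop :=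
  ∃ (u v : V) (p : G.Walk u v), p.IsPath ∧ p.support.length = l

noncomputable def signlessLaplacian {V : Type*} [Fintype V] [DecidableEq V]
    (G : SimpleGraph V) : Matrix V V ℝ :=
  letI : DecidableRel G.Adj := Classical.decRel _
  Matrix.diagonal (fun v => (deg G v : ℝ)) + G.adjMatrix ℝ

theorem signlessLaplacian_isHermitian {V : Type*} [Fintype V] [DecidableEq V]
    (G : SimpleGraph V) : (signlessLaplacian G).IsHermitian := by
  letI : DecidableRel G.Adj := Classical.decRel _
  unfold signlessLaplacian
  refine (Matrix.isHermitian_diagonal _).add ?_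
  rw [Matrix.IsHermitian, Matrix.conjTranspose_eq_transpose_of_trivial]
  exact G.isSymm_adjMatrix

/-- The `Q`-index of a graph: the largest eigenvalue of its signless Laplacian. -/
noncomputable def qIndex {V : Type*} [Fintype V] [DecidableEq V] (G : SimpleGraph V) : ℝ :=
  ⨆ v, (signlessLaplacian_isHermitian G).eigenvalues v

noncomputable def adjMat {V : Type*} [Fintype V] (G : SimpleGraph V) : Matrix V V ℝ :=
  letI : DecidableRel G.Adj := Classical.decRel _
  G.adjMatrix ℝ

theorem adjMat_isHermitian {V : Type*} [Fintype V] (G : SimpleGraph V) :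
    (adjMat G).IsHermitian := by
  letI : DecidableRel G.Adj := Classical.decRel _
  unfold adjMat
  rw [Matrix.IsHermitian, Matrix.conjTranspose_eq_transpose_of_trivial]
  exact G.isSymm_adjMatrix

/-- The spectral radius `μ`: the largest eigenvalue of the adjacency matrix. -/
noncomputable def muIndex {V : Type*} [Fintype V] [DecidableEq V] (G : SimpleGraph V) : ℝ :=
  ⨆ v, (adjMat_isHermitian G).eigenvalues v

/-- `S_{n,k} = K_k ∨ \overline{K_{n-k}}`: the first `k` vertices form a clique joined to all. -/
def Snk (n k : ℕ) : SimpleGraph (Fin n) :=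
  SimpleGraph.fromRel (fun i j => (i : ℕ) < k ∨ (j : ℕ) < k)

/-- `S_{n,k}^+`: `S_{n,k}` plus one edge inside the independent set. -/
def SnkPlus (n k : ℕ) : SimpleGraph (Fin n) :=
  SimpleGraph.fromRel (fun i j => (i : ℕ) < k ∨ (j : ℕ) < k ∨ ((i : ℕ) = k ∧ (j : ℕ) = k + 1))

/-- `L_{t,k} = K_1 ∨ tK_k`: `t` cliques of order `k+1` sharing a common center `none`. -/
def LGraph (t k : ℕ) : SimpleGraph (Option (Fin t × Fin k)) :=
  SimpleGraph.fromRel (fun x y => x = none ∨ ∃ i a b, x = some (i, a) ∧ y = some (i, b))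

/-- `K_1 ∨ (sK_k ∪ K_m)`. -/
def K1JoinCliques (s k m : ℕ) : SimpleGraph (Option ((Fin s × Fin k) ⊕ Fin m)) :=
  SimpleGraph.fromRel (fun x y => x = none ∨
    (∃ i a b, x = some (Sum.inl (i, a)) ∧ y = some (Sum.inl (i, b))) ∨
    (∃ a b, x = some (Sum.inr a) ∧ y = some (Sum.inr b)))

/-- Two disjoint copies of `L_{s,k}` and `L_{t,k}` with their centers joined by an edge. -/
def DoubleL (s t k : ℕ) : SimpleGraph (Option (Fin s × Fin k) ⊕ Option (Fin t × Fin k)) :=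
  SimpleGraph.fromRel (fun x y =>
    (∃ a b, x = Sum.inl a ∧ y = Sum.inl b ∧ (LGraph s k).Adj a b) ∨
    (∃ a b, x = Sum.inr a ∧ y = Sum.inr b ∧ (LGraph t k).Adj a b) ∨
    (x = Sum.inl none ∧ y = Sum.inr none))

/-- `G` is (a copy of) a subgraph of `H`. -/
def IsSubgraphOf {V W : Type*} (G : SimpleGraph V) (H : SimpleGraph W) : Prop :=
  ∃ f : V ↪ W, ∀ a b, G.Adj a b → H.Adj (f a) (f b)

/-- `G` contains `m` pairwise disjoint edges. -/
def HasMatching {V : Type*} (G : SimpleGraph V) (m : ℕ) : Prop :=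
  ∃ M : Finset (Sym2 V), M.card = m ∧ (∀ e ∈ M, e ∈ G.edgeSet) ∧
    ∀ e ∈ M, ∀ f ∈ M, e ≠ f → ∀ v : V, ¬(v ∈ e ∧ v ∈ f)

/-- `G` is 2-connected: at least 3 vertices, and deleting any vertex leaves a connected graph. -/
def TwoConnected {V : Type*} [Fintype V] (G : SimpleGraph V) : Prop :=
  3 ≤ Fintype.card V ∧ ∀ v : V, (G.induce {w : V | w ≠ v}).Connected

open Classical in
theorem deg_eq_card_filter {V : Type*} [Fintype V] (G : SimpleGraph V) (v : V) :
    deg G v = (Finset.univ.filter (fun u => G.Adj v u)).card := by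
  rw [deg, Nat.card_eq_fintype_card, ← Set.toFinset_card]
  congr 1
  ext u
  simp

section Rayleigh

variable {ι : Type*} [Fintype ι] [DecidableEq ι]

theorem Matrix.IsHermitian.posSemidef_iSup_eigenvalues_sub {A : Matrix ι ι ℝ}
    (hA : A.IsHermitian) :
    (algebraMap ℝ (Matrix ι ι ℝ) (⨆ i, hA.eigenvalues i) - A).PosSemidef := by
  set c := ⨆ i, hA.eigenvalues i with hc
  have hH : (algebraMap ℝ (Matrix ι ι ℝ) c - A).IsHermitian := by
    refine Matrix.IsHermitian.sub ?_ hA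
    rw [Matrix.algebraMap_eq_diagonal]
    exact Matrix.isHermitian_diagonal _
  rw [hH.posSemidef_iff_eigenvalues_nonneg]
  intro i
  have h1 := hH.eigenvalues_mem_spectrum_real i
  rw [← spectrum.singleton_sub_eq, Set.singleton_sub, hA.spectrum_real_eq_range_eigenvalues] at h1
  obtain ⟨_, ⟨j, rfl⟩, h2⟩ := h1
  have h3 : hA.eigenvalues j ≤ c := le_ciSup (Set.finite_range _).bddAbove j
  simp only [Pi.zero_apply]
  linarith

end Rayleigh

section QIndex

variable {V : Type*} [Fintype V] [DecidableEq V]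

open Classical in
theorem signlessLaplacian_mulVec_apply (G : SimpleGraph V) (x : V → ℝ) (v : V) :
    (signlessLaplacian G *ᵥ x) v = deg G v * x v + ∑ u, if G.Adj v u then x u else 0 := by
  rw [signlessLaplacian, Matrix.add_mulVec, Pi.add_apply, Matrix.mulVec_diagonal,
    SimpleGraph.adjMatrix_mulVec_apply, ← Finset.sum_filter]
  congr 1
  refine Finset.sum_congr ?_ fun _ _ => rfl
  ext u
  simp

theorem dotProduct_signlessLaplacian_mulVec_le (G : SimpleGraph V) (x : V → ℝ) :
    x ⬝ᵥ (signlessLaplacian G *ᵥ x) ≤ qIndex G * (x ⬝ᵥ x) := by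
  have h := (signlessLaplacian_isHermitian G).posSemidef_iSup_eigenvalues_sub.dotProduct_mulVec_nonneg x
  rw [Matrix.sub_mulVec, Algebra.algebraMap_eq_smul_one, Matrix.smul_mulVec, Matrix.one_mulVec] at h
  simp only [star_trivial, dotProduct_sub, dotProduct_smul, smul_eq_mul] at h
  rw [qIndex]
  linarith

theorem signlessLaplacian_mulVec_eq_of_dotProduct_eq (G : SimpleGraph V) (x : V → ℝ)
    (h : x ⬝ᵥ (signlessLaplacian G *ᵥ x) = qIndex G * (x ⬝ᵥ x)) :
    signlessLaplacian G *ᵥ x = qIndex G • x := by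
  have h1 := ((signlessLaplacian_isHermitian G).posSemidef_iSup_eigenvalues_sub.dotProduct_mulVec_zero_iff x).1
  rw [Matrix.sub_mulVec, Algebra.algebraMap_eq_smul_one, Matrix.smul_mulVec, Matrix.one_mulVec] at h1
  simp only [star_trivial, dotProduct_sub, dotProduct_smul, smul_eq_mul] at h1
  rw [qIndex] at h ⊢
  exact (sub_eq_zero.1 (h1 (by linarith))).symm

theorem le_qIndex_of_subinvariant (G : SimpleGraph V) (x : V → ℝ) (c : ℝ) (hx : ∀ v, 0 ≤ x v)
    (hx0 : x ≠ 0) (h : ∀ v, c * x v ≤ (signlessLaplacian G *ᵥ x) v) : c ≤ qIndex G := by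
  have h1 : c * (x ⬝ᵥ x) ≤ x ⬝ᵥ (signlessLaplacian G *ᵥ x) := by
    simp only [dotProduct, Finset.mul_sum]
    exact Finset.sum_le_sum fun v _ => by nlinarith [mul_le_mul_of_nonneg_left (h v) (hx v)]
  have h2 : 0 < x ⬝ᵥ x := by
    refine lt_of_le_of_ne (Finset.sum_nonneg fun v _ => mul_self_nonneg _) ?_
    exact fun h => hx0 (dotProduct_self_eq_zero.1 h.symm)
  exact le_of_mul_le_mul_right (h1.trans (dotProduct_signlessLaplacian_mulVec_le G x)) h2

open Classical in
/-- A nonnegative nonzero vector `x` with `q(G) x ≤ Q(G) x`. -/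
theorem exists_qIndex_subinvariant [Nonempty V] (G : SimpleGraph V) :
    ∃ x : V → ℝ, (∀ v, 0 ≤ x v) ∧ x ≠ 0 ∧
      ∀ v, qIndex G * x v ≤ deg G v * x v + ∑ u, if G.Adj v u then x u else 0 := by
  set hA := signlessLaplacian_isHermitian G
  obtain ⟨i, hi⟩ := exists_eq_ciSup_of_finite (f := hA.eigenvalues)
  have he := hA.mulVec_eigenvectorBasis i
  set e : V → ℝ := (hA.eigenvectorBasis i).ofLp
  have he0 : e ≠ 0 := by
    intro h
    have := hA.eigenvectorBasis.orthonormal.ne_zero i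
    exact this (by ext v; exact congrFun h v)
  refine ⟨fun v => |e v|, fun v => abs_nonneg _, ?_, fun v => ?_⟩
  · intro h
    exact he0 (by ext v; simpa using congrFun h v)
  · have h1 := congrFun he v
    rw [signlessLaplacian_mulVec_apply, hi] at h1
    simp only [Pi.smul_apply, smul_eq_mul] at h1
    calc qIndex G * |e v| ≤ |qIndex G * e v| := by
          rw [abs_mul]
          exact mul_le_mul_of_nonneg_right (le_abs_self _) (abs_nonneg _)
      _ = |deg G v * e v + ∑ u, if G.Adj v u then e u else 0| := by rw [h1, qIndex]
      _ ≤ |deg G v * e v| + ∑ u, |if G.Adj v u then e u else 0| :=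
          (abs_add_le _ _).trans (add_le_add_right (Finset.abs_sum_le_sum_abs _ _) _)
      _ = _ := by
          rw [abs_mul, Nat.abs_cast]
          congr 1
          refine Finset.sum_congr rfl fun u _ => ?_
          split_ifs <;> simp

open Classical in
theorem dotProduct_signlessLaplacian_mulVec (G : SimpleGraph V) (x : V → ℝ) :
    2 * (x ⬝ᵥ (signlessLaplacian G *ᵥ x)) =
      ∑ v, ∑ u, if G.Adj v u then (x v + x u) ^ 2 else 0 := by
  have h1 : x ⬝ᵥ (signlessLaplacian G *ᵥ x) =
      ∑ v, ∑ u, if G.Adj v u then x v ^ 2 + x v * x u else 0 := by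
    simp only [dotProduct, signlessLaplacian_mulVec_apply]
    refine Finset.sum_congr rfl fun v _ => ?_
    rw [deg_eq_card_filter, Finset.card_filter]
    push_cast
    rw [mul_add, Finset.sum_mul, Finset.mul_sum, Finset.mul_sum, ← Finset.sum_add_distrib]
    refine Finset.sum_congr rfl fun u _ => ?_
    split_ifs <;> ring
  have h2 : x ⬝ᵥ (signlessLaplacian G *ᵥ x) =
      ∑ v, ∑ u, if G.Adj v u then x u ^ 2 + x v * x u else 0 := by
    rw [h1, Finset.sum_comm]
    refine Finset.sum_congr rfl fun v _ => Finset.sum_congr rfl fun u _ => ?_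
    simp only [G.adj_comm u v, mul_comm (x u)]
  rw [two_mul]
  nth_rewrite 1 [h1]
  rw [h2, ← Finset.sum_add_distrib]
  refine Finset.sum_congr rfl fun v _ => ?_
  rw [← Finset.sum_add_distrib]
  refine Finset.sum_congr rfl fun u _ => ?_
  split_ifs <;> ring

open Classical in
/-- Every lower bound `q ≥ |V|` for the `Q`-index yields a lower bound for a sum over degrees. -/
theorem half_qIndex_le_sum [Nonempty V] (G : SimpleGraph V) (q : ℝ) (hq : q ≤ qIndex G)
    (hV : (Fintype.card V : ℝ) ≤ q) :
    q / 2 ≤ ∑ v, (deg G v : ℝ) / (q + 1 - deg G v) := by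
  obtain ⟨x, hx, hx0, h⟩ := exists_qIndex_subinvariant G
  replace h : ∀ v, q * x v ≤ deg G v * x v + ∑ u, if G.Adj v u then x u else 0 := fun v =>
    (mul_le_mul_of_nonneg_right hq (hx v)).trans (h v)
  have hd : ∀ v, (deg G v : ℝ) ≤ q := fun v => by
    refine le_trans ?_ hV
    rw [deg_eq_card_filter]
    exact_mod_cast Finset.card_le_univ _
  set s := ∑ v, x v with hs
  have hs0 : 0 < s := by
    obtain ⟨v, hv⟩ := Function.ne_iff.1 hx0
    exact Finset.sum_pos' (fun v _ => hx v) ⟨v, Finset.mem_univ _, lt_of_le_of_ne (hx v) (Ne.symm hv)⟩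
  have h1 : ∀ v, (q + 1 - deg G v) * x v ≤ s := fun v => by
    have : (∑ u, if G.Adj v u then x u else 0) + x v ≤ s := by
      rw [hs, ← Finset.sum_erase_add _ _ (Finset.mem_univ v),
        ← Finset.sum_erase_add Finset.univ x (Finset.mem_univ v)]
      simp only [SimpleGraph.irrefl, if_false, add_zero]
      refine add_le_add_left (Finset.sum_le_sum fun u _ => ?_) _
      split_ifs
      · exact le_rfl
      · exact hx u
    linarith [h v]
  have h2 : q * s ≤ 2 * ∑ v, deg G v * x v := by
    have h3 : ∑ v, ∑ u, (if G.Adj v u then x u else 0) = ∑ v, deg G v * x v := by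
      rw [Finset.sum_comm]
      refine Finset.sum_congr rfl fun u _ => ?_
      simp only [G.adj_comm _ u]
      rw [← Finset.sum_filter, Finset.sum_const, deg_eq_card_filter, nsmul_eq_mul]
    calc q * s = ∑ v, q * x v := Finset.mul_sum _ _ _
      _ ≤ ∑ v, (deg G v * x v + ∑ u, if G.Adj v u then x u else 0) :=
        Finset.sum_le_sum fun v _ => h v
      _ = _ := by rw [Finset.sum_add_distrib, h3, two_mul]
  have h4 : ∑ v, deg G v * x v ≤ s * ∑ v, (deg G v : ℝ) / (q + 1 - deg G v) := by
    rw [Finset.mul_sum]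
    refine Finset.sum_le_sum fun v _ => ?_
    have hp : 0 < q + 1 - deg G v := by linarith [hd v]
    rw [← mul_div_assoc, le_div_iff₀ hp]
    nlinarith [mul_le_mul_of_nonneg_left (h1 v) (Nat.cast_nonneg (α := ℝ) (deg G v))]
  have h5 : s * (q / 2) ≤ s * ∑ v, (deg G v : ℝ) / (q + 1 - deg G v) := by linarith
  exact le_of_mul_le_mul_left h5 hs0

end QIndex

section Paths

variable {V : Type*}

theorem hasPathOn_of_isChain {G : SimpleGraph V} {l : List V} (hc : l.IsChain G.Adj)
    (hn : l.Nodup) {m : ℕ} (hm : 1 ≤ m) (hl : m ≤ l.length) : HasPathOn G m := by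
  have hlen : (l.take m).length = m := by
    rw [List.length_take]
    omega
  have hne : l.take m ≠ [] := by
    intro h
    rw [h, List.length_nil] at hlen
    omega
  refine ⟨_, _, SimpleGraph.Walk.ofSupport (l.take m) hne (hc.take m), ?_, ?_⟩
  · rw [SimpleGraph.Walk.isPath_def, SimpleGraph.Walk.support_ofSupport]
    exact hn.sublist (List.take_sublist m l)
  · rw [SimpleGraph.Walk.support_ofSupport, hlen]

theorem exists_isChain_perm_cons_of_closed {G : SimpleGraph V} {c : List V}
    (hc : c.IsChain G.Adj) (hcl : ∀ a ∈ c.getLast?, ∀ b ∈ c.head?, G.Adj a b)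
    {y z : V} (hz : z ∈ c) (hyz : G.Adj y z) :
    ∃ l : List V, l.IsChain G.Adj ∧ l.Perm (y :: c) := by
  obtain ⟨s, t, rfl⟩ := List.append_of_mem hz
  obtain ⟨hs, ht, hst⟩ := List.isChain_append.1 hc
  refine ⟨(y :: z :: t) ++ s, ?_, ?_⟩
  · refine List.isChain_append.2 ⟨List.isChain_cons_cons.2 ⟨hyz, ht⟩, hs, ?_⟩
    intro a ha b hb
    refine hcl a ?_ b ?_
    · simpa using ha
    · cases s with
      | nil => simp at hb
      | cons => simpa using hb
  · rw [List.cons_append]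
    exact List.Perm.cons y List.perm_append_comm

open Classical in
/-- A longest path all of whose ends have large degree spans a set closed under adjacency. -/
theorem mem_of_adj_of_longest {G : SimpleGraph V} {U : Finset V} {l : List V}
    (hc : l.IsChain G.Adj) (hn : l.Nodup) (hU : ∀ v ∈ l, v ∈ U)
    (hmax : ∀ l' : List V, l'.IsChain G.Adj → l'.Nodup → (∀ v ∈ l', v ∈ U) →
      l'.length ≤ l.length)
    {d : ℕ} (hdeg : ∀ v ∈ U, d ≤ (U.filter (G.Adj v)).card) (hd : l.length ≤ 2 * d)
    {y z : V} (hz : z ∈ l) (hy : y ∈ U) (hyz : G.Adj y z) : y ∈ l := by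
  by_contra hyl
  have hpos : 0 < l.length := List.length_pos_of_mem hz
  have hfst : ∀ u ∈ U, G.Adj l[0] u → u ∈ l := by
    intro u hu hadj
    by_contra hul
    have := hmax (u :: l) (List.isChain_cons.2 ⟨fun b hb => ?_, hc⟩) (List.nodup_cons.2 ⟨hul, hn⟩)
      (by simpa [hu] using hU)
    · simp at this
    · rw [List.head?_eq_getElem?, List.getElem?_eq_getElem hpos] at hb
      obtain rfl : l[0] = b := by simpa using hb
      exact hadj.symm
  have hlst : ∀ u ∈ U, G.Adj (l[l.length - 1]) u → u ∈ l := by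
    intro u hu hadj
    by_contra hul
    have := hmax (l ++ [u]) (List.isChain_append.2 ⟨hc, List.isChain_singleton u, ?_⟩)
      (by rw [List.nodup_append]; simpa [hn] using fun a ha (h : a = u) => hul (h ▸ ha)) ?_
    · simp at this
    · intro a ha b hb
      rw [List.getLast?_eq_getElem?, List.getElem?_eq_getElem (by omega)] at ha
      obtain rfl : l[l.length - 1] = a := by simpa using ha
      obtain rfl : u = b := by simpa using hb
      exact hadj
    · intro v hv
      rcases List.mem_append.1 hv with h | h
      · exact hU v h
      · rw [List.mem_singleton.1 h]
        exact hu
  set A := U.filter (G.Adj l[0]) with hA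
  set B := U.filter (G.Adj l[l.length - 1]) with hB
  have hidx : ∀ u ∈ l, l.idxOf u < l.length := fun u hu => List.idxOf_lt_length_iff.2 hu
  have hA1 : ∀ u ∈ A, u ∈ l ∧ l.idxOf u ≠ 0 := by
    intro u hu
    rw [hA, Finset.mem_filter] at hu
    have hul := hfst u hu.1 hu.2
    refine ⟨hul, fun h0 => ?_⟩
    have h1 := List.getElem_idxOf (hidx u hul)
    simp only [h0] at h1
    exact hu.2.ne h1
  have hB1 : ∀ u ∈ B, u ∈ l ∧ l.idxOf u ≠ l.length - 1 := by
    intro u hu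
    rw [hB, Finset.mem_filter] at hu
    have hul := hlst u hu.1 hu.2
    refine ⟨hul, fun h0 => ?_⟩
    have h1 := List.getElem_idxOf (hidx u hul)
    simp only [h0] at h1
    exact hu.2.ne h1
  have hinj : ∀ u ∈ l, ∀ v ∈ l, l.idxOf u = l.idxOf v → u = v := fun u hu v _ h =>
    (List.idxOf_inj hu).1 h
  set X := A.image (fun u => l.idxOf u - 1) with hX
  set Y := B.image (fun u => l.idxOf u) with hY
  have hXc : X.card = A.card := by
    refine Finset.card_image_of_injOn fun u hu v hv h => ?_
    have h1 := hA1 u hu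
    have h2 := hA1 v hv
    refine hinj u h1.1 v h2.1 ?_
    have : l.idxOf u - 1 = l.idxOf v - 1 := h
    omega
  have hYc : Y.card = B.card := by
    refine Finset.card_image_of_injOn fun u hu v hv h => ?_
    exact hinj u (hB1 u hu).1 v (hB1 v hv).1 h
  have hsub : X ∪ Y ⊆ Finset.range (l.length - 1) := by
    intro i hi
    rw [Finset.mem_range]
    rcases Finset.mem_union.1 hi with h | h
    · obtain ⟨u, hu, rfl⟩ := Finset.mem_image.1 h
      have h1 := hA1 u hu
      have := hidx u h1.1
      omega
    · obtain ⟨u, hu, rfl⟩ := Finset.mem_image.1 h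
      have h1 := hB1 u hu
      have := hidx u h1.1
      omega
  have hnd : ¬Disjoint X Y := by
    intro hdis
    have h1 := Finset.card_le_card hsub
    rw [Finset.card_union_of_disjoint hdis, hXc, hYc, Finset.card_range] at h1
    have h2 := hdeg _ (hU l[0] (List.getElem_mem _))
    have h3 := hdeg _ (hU l[l.length - 1] (List.getElem_mem _))
    rw [← hA] at h2
    rw [← hB] at h3
    omega
  obtain ⟨i, hiX, hiY⟩ := Finset.not_disjoint_iff.1 hnd
  obtain ⟨u, hu, hui⟩ := Finset.mem_image.1 hiX
  obtain ⟨v, hv, hvi⟩ := Finset.mem_image.1 hiY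
  have hi : i + 1 < l.length := by
    have := Finset.mem_range.1 (hsub (Finset.mem_union_left _ hiX))
    omega
  have hu1 : l[i + 1] = u := by
    have h1 := List.getElem_idxOf (hidx u (hA1 u hu).1)
    have h2 : l.idxOf u = i + 1 := by
      have := (hA1 u hu).2
      omega
    simp only [h2] at h1
    exact h1
  have hv1 : l[i] = v := by
    have h1 := List.getElem_idxOf (hidx v (hB1 v hv).1)
    simp only [hvi] at h1
    exact h1
  have hadj0 : G.Adj l[0] l[i + 1] := by
    rw [hu1]
    exact (Finset.mem_filter.1 hu).2
  have hadj1 : G.Adj l[l.length - 1] l[i] := by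
    rw [hv1]
    exact (Finset.mem_filter.1 hv).2
  set c := (l.take (i + 1)).reverse ++ l.drop (i + 1) with hcdef
  have hperm : c.Perm l := by
    have h1 : c.Perm (l.take (i + 1) ++ l.drop (i + 1)) :=
      List.Perm.append_right _ (List.reverse_perm _)
    rwa [List.take_append_drop] at h1
  have hcc : c.IsChain G.Adj := by
    refine List.isChain_append.2 ⟨?_, hc.drop _, ?_⟩
    · rw [List.isChain_reverse]
      exact (hc.take _).imp fun _ _ h => h.symm
    · intro a ha b hb
      rw [List.getLast?_reverse, List.head?_take] at ha
      rw [List.head?_drop, List.getElem?_eq_getElem hi] at hb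
      simp only [Nat.add_eq_zero_iff, one_ne_zero, and_false, if_false] at ha
      rw [List.head?_eq_getElem?, List.getElem?_eq_getElem hpos] at ha
      obtain rfl : l[0] = a := by simpa using ha
      obtain rfl : l[i + 1] = b := by simpa using hb
      exact hadj0
  have hcl : ∀ a ∈ c.getLast?, ∀ b ∈ c.head?, G.Adj a b := by
    intro a ha b hb
    have hal : a = l[l.length - 1] := by
      rw [hcdef, List.getLast?_append, List.getLast?_drop, if_neg (by omega),
        List.getLast?_eq_getElem?, List.getElem?_eq_getElem (by omega)] at ha
      simpa using ha.symm
    have hbl : b = l[i] := by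
      rw [hcdef, List.head?_append, List.head?_reverse, List.getLast?_eq_getElem?,
        List.length_take, min_eq_left (by omega), List.getElem?_take_of_lt (by omega),
        List.getElem?_eq_getElem (by omega)] at hb
      simpa using hb.symm
    rw [hal, hbl]
    exact hadj1
  obtain ⟨l', hl'c, hl'p⟩ :=
    exists_isChain_perm_cons_of_closed hcc hcl (hperm.mem_iff.2 hz) hyz
  have hp2 : l'.Perm (y :: l) := hl'p.trans (hperm.cons y)
  have := hmax l' hl'c (hp2.nodup_iff.2 (List.nodup_cons.2 ⟨hyl, hn⟩)) (fun v hv => by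
    rcases List.mem_cons.1 (hp2.mem_iff.1 hv) with h | h
    · rw [h]
      exact hy
    · exact hU v h)
  rw [hp2.length_eq, List.length_cons] at this
  omega

open Classical in
/-- The Erdős–Gallai bound, as a bound on degree sums inside a vertex set. -/
theorem sum_card_filter_adj_le {G : SimpleGraph V} {k : ℕ} (hG : ¬HasPathOn G (2 * k + 2))
    (U : Finset V) : ∑ v ∈ U, (U.filter (G.Adj v)).card ≤ 2 * k * U.card := by
  have hlen : ∀ l : List V, l.IsChain G.Adj → l.Nodup → l.length ≤ 2 * k + 1 := by
    intro l hc hn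
    by_contra h
    exact hG (hasPathOn_of_isChain hc hn (by omega) (by omega))
  induction U using Finset.strongInduction with
  | H U ih =>
  by_cases hsmall : ∃ v ∈ U, (U.filter (G.Adj v)).card ≤ k
  · obtain ⟨v, hv, hvk⟩ := hsmall
    have h1 := ih (U.erase v) (Finset.erase_ssubset hv)
    have h2 : ∀ u, (U.filter (G.Adj u)).card =
        ((U.erase v).filter (G.Adj u)).card + if G.Adj v u then 1 else 0 := by
      intro u
      rw [Finset.filter_erase]
      by_cases h : G.Adj v u
      · rw [if_pos h, Finset.card_erase_add_one]
        exact Finset.mem_filter.2 ⟨hv, h.symm⟩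
      · rw [if_neg h, add_zero, Finset.erase_eq_of_notMem]
        exact fun hm => h (Finset.mem_filter.1 hm).2.symm
    have h3 : ∑ u ∈ U.erase v, (if G.Adj v u then 1 else 0) = (U.filter (G.Adj v)).card := by
      rw [← Finset.card_filter, h2 v, if_neg (G.irrefl), add_zero]
    have h4 : ∑ u ∈ U.erase v, (U.filter (G.Adj u)).card =
        ∑ u ∈ U.erase v, ((U.erase v).filter (G.Adj u)).card + (U.filter (G.Adj v)).card := by
      rw [← h3, ← Finset.sum_add_distrib]
      exact Finset.sum_congr rfl fun u _ => h2 u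
    rw [← Finset.sum_erase_add _ _ hv, h4, ← Finset.card_erase_add_one hv]
    nlinarith
  · push Not at hsmall
    rcases U.eq_empty_or_nonempty with rfl | ⟨v₀, hv₀⟩
    · simp
    let P : ℕ → Prop := fun m => ∃ l : List V, l.IsChain G.Adj ∧ l.Nodup ∧ (∀ v ∈ l, v ∈ U) ∧
      l.length = m
    have hP1 : P 1 := ⟨[v₀], List.isChain_singleton _, List.nodup_singleton _, by simpa using hv₀,
      rfl⟩
    obtain ⟨l, hc, hn, hU, hl⟩ := Nat.findGreatest_spec (P := P) (n := 2 * k + 1) (by omega) hP1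
    have hmax : ∀ l' : List V, l'.IsChain G.Adj → l'.Nodup → (∀ v ∈ l', v ∈ U) →
        l'.length ≤ l.length := by
      intro l' hc' hn' hU'
      rw [hl]
      exact Nat.le_findGreatest (hlen l' hc' hn') ⟨l', hc', hn', hU', rfl⟩
    have hlpos : 1 ≤ l.length := by
      rw [hl]
      exact Nat.le_findGreatest (by omega) hP1
    have hclosed := fun y z => mem_of_adj_of_longest (y := y) (z := z) hc hn hU hmax
      (d := k + 1) hsmall ((hlen l hc hn).trans (by omega))
    set W := l.toFinset with hW
    have hWU : W ⊆ U := fun v hv => hU v (List.mem_toFinset.1 hv)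
    have hWc : W.card = l.length := List.toFinset_card_of_nodup hn
    have hWpos : W.Nonempty := Finset.card_pos.1 (by omega)
    have h1 := ih (U \ W) (Finset.sdiff_ssubset hWU hWpos)
    have h2 : ∀ v ∈ W, (U.filter (G.Adj v)).card ≤ 2 * k := by
      intro v hv
      have hsub : U.filter (G.Adj v) ⊆ W.erase v := by
        intro u hu
        obtain ⟨huU, huv⟩ := Finset.mem_filter.1 hu
        exact Finset.mem_erase.2 ⟨huv.ne', List.mem_toFinset.2
          (hclosed u v (List.mem_toFinset.1 hv) huU huv.symm)⟩
      have h3 := Finset.card_le_card hsub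
      rw [Finset.card_erase_of_mem hv, hWc] at h3
      have := hlen l hc hn
      omega
    have h3 : ∀ v ∈ U \ W, (U.filter (G.Adj v)).card = ((U \ W).filter (G.Adj v)).card := by
      intro v hv
      obtain ⟨hvU, hvW⟩ := Finset.mem_sdiff.1 hv
      congr 1
      ext u
      simp only [Finset.mem_filter, Finset.mem_sdiff]
      constructor
      · rintro ⟨huU, huv⟩
        exact ⟨⟨huU, fun huW => hvW (List.mem_toFinset.2
          (hclosed v u (List.mem_toFinset.1 huW) hvU huv))⟩, huv⟩
      · rintro ⟨⟨huU, -⟩, huv⟩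
        exact ⟨huU, huv⟩
    have h4 := Finset.sum_le_sum h2
    rw [Finset.sum_const, smul_eq_mul] at h4
    rw [← Finset.sum_sdiff hWU, Finset.sum_congr rfl h3, ← Finset.card_sdiff_add_card_eq_card hWU]
    nlinarith

theorem sum_deg_le [Fintype V] {G : SimpleGraph V} {k : ℕ} (hG : ¬HasPathOn G (2 * k + 2)) :
    ∑ v, deg G v ≤ 2 * k * Fintype.card V := by
  classical
  have h := sum_card_filter_adj_le hG Finset.univ
  rw [Finset.card_univ] at h
  refine le_trans (le_of_eq (Finset.sum_congr rfl fun v _ => ?_)) h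
  rw [deg_eq_card_filter]

/-- A path ending at a vertex of large degree can be extended by alternating between the members
of a list of vertices of large degree and common neighbours of consecutive members. -/
theorem exists_alternating_path [Fintype V] {G : SimpleGraph V} {k : ℕ}
    (hV : 2 * k + 2 ≤ Fintype.card V) (rest : List V) (b : V) (p : List V)
    (hc : (b :: p).IsChain G.Adj) (hn : (b :: (p ++ rest)).Nodup)
    (hdeg : ∀ t ∈ b :: rest, Fintype.card V + 2 * k ≤ 2 * deg G t)
    (hlen : p.length + 2 * rest.length ≤ 2 * k) :
    ∃ l : List V, l.IsChain G.Adj ∧ l.Nodup ∧ l.length = p.length + 2 * rest.length + 2 := by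
  classical
  simp only [deg_eq_card_filter] at hdeg
  induction rest generalizing b p with
  | nil =>
    have hb := hdeg b (by simp)
    obtain ⟨c, hcN, hcp⟩ := Finset.exists_mem_notMem_of_card_lt_card
      (s := p.toFinset) (t := Finset.univ.filter (fun u => G.Adj b u)) (by
        have := List.toFinset_card_le p
        simp only [List.length_nil] at hlen
        omega)
    have hbc : G.Adj b c := (Finset.mem_filter.1 hcN).2
    rw [List.mem_toFinset] at hcp
    rw [List.append_nil] at hn
    refine ⟨c :: b :: p, List.isChain_cons_cons.2 ⟨hbc.symm, hc⟩, ?_, by simp⟩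
    rw [List.nodup_cons]
    refine ⟨?_, hn⟩
    rw [List.mem_cons]
    rintro (h | h)
    · exact hbc.ne' h
    · exact hcp h
  | cons b' rest ih =>
    have hb := hdeg b (by simp)
    have hb' := hdeg b' (by simp)
    simp only [List.length_cons] at hlen
    obtain ⟨c, hcN, hcp⟩ := Finset.exists_mem_notMem_of_card_lt_card
      (s := (p ++ rest).toFinset) (t := Finset.univ.filter (fun u => G.Adj b u) ∩
        Finset.univ.filter (fun u => G.Adj b' u)) (by
        have h1 := List.toFinset_card_le (p ++ rest)
        have h2 := Finset.card_union_add_card_inter (Finset.univ.filter (fun u => G.Adj b u))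
          (Finset.univ.filter (fun u => G.Adj b' u))
        have h3 := Finset.card_le_univ (Finset.univ.filter (fun u => G.Adj b u) ∪
          Finset.univ.filter (fun u => G.Adj b' u))
        rw [List.length_append] at h1
        omega)
    obtain ⟨hc1, hc2⟩ := Finset.mem_inter.1 hcN
    have hbc : G.Adj b c := (Finset.mem_filter.1 hc1).2
    have hbc' : G.Adj b' c := (Finset.mem_filter.1 hc2).2
    rw [List.mem_toFinset] at hcp
    have hcb := hbc.ne
    have hcb' := hbc'.ne
    obtain ⟨l, h1, h2, h3⟩ := ih b' (c :: b :: p)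
      (List.isChain_cons_cons.2 ⟨hbc', List.isChain_cons_cons.2 ⟨hbc.symm, hc⟩⟩)
      (by
        simp only [List.nodup_cons, List.nodup_append, List.mem_append, List.mem_cons,
          List.cons_append] at hn hcp ⊢
        grind)
      (by simp only [List.length_cons]; omega)
      (fun t ht => hdeg t (by simp only [List.mem_cons] at ht ⊢; tauto))
    refine ⟨l, h1, h2, ?_⟩
    rw [h3]
    simp only [List.length_cons]
    omega

end Paths

section Comparison

variable {V W : Type*} [Fintype V] [Fintype W] [DecidableEq V] [DecidableEq W]

open Classical in
theorem SimpleGraph.Preconnected.eq_zero_of_apply_eq_zero {H : SimpleGraph W}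
    (hH : H.Preconnected) {y : W → ℝ} (hy : ∀ w, 0 ≤ y w) {c : ℝ}
    (h : signlessLaplacian H *ᵥ y = c • y) {a : W} (ha : y a = 0) : y = 0 := by
  have step : ∀ u v, H.Adj u v → y u = 0 → y v = 0 := by
    intro u v huv hu
    have h1 := congrFun h u
    rw [signlessLaplacian_mulVec_apply, Pi.smul_apply, hu] at h1
    simp only [mul_zero, zero_add, smul_zero] at h1
    rw [Finset.sum_eq_zero_iff_of_nonneg] at h1
    · simpa [huv] using h1 v (Finset.mem_univ v)
    · intro w _
      split_ifs
      · exact hy w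
      · exact le_rfl
  ext b
  obtain ⟨p⟩ := hH a b
  clear h
  induction p with
  | nil => exact ha
  | cons hadj _ ih => exact ih (step _ _ hadj ha)

open Classical in
/-- The `Q`-index is strictly monotone under passing to spanning subgraphs of a connected graph. -/
theorem nonempty_iso_of_qIndex_le [Nonempty V] {G : SimpleGraph V} {H : SimpleGraph W}
    (σ : V ≃ W) (hσ : ∀ u v, G.Adj u v → H.Adj (σ u) (σ v)) (hH : H.Preconnected)
    (hq : qIndex H ≤ qIndex G) : Nonempty (G ≃g H) := by
  obtain ⟨x, hx, hx0, hsub⟩ := exists_qIndex_subinvariant G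
  set y : W → ℝ := fun w => x (σ.symm w) with hy
  have hyx : ∀ v, y (σ v) = x v := fun v => by simp [hy]
  have hnorm : y ⬝ᵥ y = x ⬝ᵥ x := by
    simp only [dotProduct]
    rw [← Equiv.sum_comp σ]
    simp only [hyx]
  have hformH : 2 * (y ⬝ᵥ (signlessLaplacian H *ᵥ y)) =
      ∑ v, ∑ u, if H.Adj (σ v) (σ u) then (x v + x u) ^ 2 else 0 := by
    rw [dotProduct_signlessLaplacian_mulVec, ← Equiv.sum_comp σ]
    refine Finset.sum_congr rfl fun v _ => ?_
    rw [← Equiv.sum_comp σ]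
    simp only [hyx]
  have hformG := dotProduct_signlessLaplacian_mulVec G x
  have hGq : qIndex G * (x ⬝ᵥ x) ≤ x ⬝ᵥ (signlessLaplacian G *ᵥ x) := by
    simp only [dotProduct, Finset.mul_sum]
    refine Finset.sum_le_sum fun v _ => ?_
    have h1 := mul_le_mul_of_nonneg_left (hsub v) (hx v)
    rw [← signlessLaplacian_mulVec_apply] at h1
    linarith
  have hle : ∀ v u, (if G.Adj v u then (x v + x u) ^ 2 else 0) ≤
      if H.Adj (σ v) (σ u) then (x v + x u) ^ 2 else 0 := by
    intro v u
    by_cases h : G.Adj v u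
    · simp [h, hσ v u h]
    · rw [if_neg h]
      split_ifs
      · positivity
      · exact le_rfl
  have hsum : ∑ v, ∑ u, (if G.Adj v u then (x v + x u) ^ 2 else 0) ≤
      ∑ v, ∑ u, if H.Adj (σ v) (σ u) then (x v + x u) ^ 2 else 0 :=
    Finset.sum_le_sum fun v _ => Finset.sum_le_sum fun u _ => hle v u
  have hHq := dotProduct_signlessLaplacian_mulVec_le H y
  have hxx : 0 ≤ x ⬝ᵥ x := Finset.sum_nonneg fun v _ => mul_self_nonneg _
  have hqm := mul_le_mul_of_nonneg_right hq hxx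
  rw [hnorm] at hHq
  have heqH : y ⬝ᵥ (signlessLaplacian H *ᵥ y) = qIndex H * (y ⬝ᵥ y) := by
    rw [hnorm]
    linarith
  have heig := signlessLaplacian_mulVec_eq_of_dotProduct_eq H y heqH
  have heqsum : ∑ v, ∑ u, (if G.Adj v u then (x v + x u) ^ 2 else 0) =
      ∑ v, ∑ u, if H.Adj (σ v) (σ u) then (x v + x u) ^ 2 else 0 := by linarith
  refine ⟨⟨σ, fun {u v} => ⟨fun h => ?_, hσ u v⟩⟩⟩
  by_contra hG
  have h1 := (Finset.sum_eq_sum_iff_of_le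
    (fun v _ => Finset.sum_le_sum fun u _ => hle v u)).1 heqsum u (Finset.mem_univ u)
  have h2 := (Finset.sum_eq_sum_iff_of_le (fun w _ => hle u w)).1 h1 v (Finset.mem_univ v)
  rw [if_neg hG, if_pos h] at h2
  have h3 : x u + x v = 0 := by
    simpa using h2.symm
  have h4 : y (σ u) = 0 := by
    rw [hyx]
    linarith [hx u, hx v]
  have h5 := hH.eq_zero_of_apply_eq_zero (fun w => hx _) heig h4
  refine hx0 (funext fun v => ?_)
  rw [← hyx]
  exact congrFun h5 (σ v)

theorem preconnected_Snk {n k : ℕ} (hk : 1 ≤ k) : (Snk n k).Preconnected := by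
  intro u v
  have hn : 0 < n := u.pos
  have h : ∀ w : Fin n, (Snk n k).Reachable ⟨0, hn⟩ w := by
    intro w
    by_cases hw : (⟨0, hn⟩ : Fin n) = w
    · rw [hw]
    · refine SimpleGraph.Adj.reachable ?_
      rw [Snk, SimpleGraph.fromRel_adj]
      exact ⟨hw, Or.inl (Or.inl hk)⟩
  exact (h u).symm.trans (h v)

open Classical in
theorem nonempty_iso_Snk_of_cover {n k : ℕ} (hk : 1 ≤ k) (hn : 0 < n) (G : SimpleGraph (Fin n))
    (hq : qIndex (Snk n k) ≤ qIndex G) (K : Finset (Fin n)) (hK : K.card = k)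
    (hcov : ∀ u v, G.Adj u v → u ∈ K ∨ v ∈ K) : Nonempty (G ≃g Snk n k) := by
  have hkn : k ≤ n := by
    rw [← hK]
    simpa using K.card_le_univ
  have : Nonempty (Fin n) := ⟨⟨0, hn⟩⟩
  have e : {v // v ∈ K} ≃ {v : Fin n // (v : ℕ) < k} := by
    refine Fintype.equivOfCardEq ?_
    rw [Fintype.card_coe, hK, Fintype.card_subtype]
    have : (Finset.univ.filter fun v : Fin n => (v : ℕ) < k).card = k := by
      rw [Fin.card_filter_val_lt]
      omega
    exact this.symm
  refine nonempty_iso_of_qIndex_le e.extendSubtype (fun u v huv => ?_) (preconnected_Snk hk) hq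
  rw [Snk, SimpleGraph.fromRel_adj]
  refine ⟨fun h => huv.ne (e.extendSubtype.injective h), Or.inl ?_⟩
  exact (hcov u v huv).imp (e.extendSubtype_mem u) (e.extendSubtype_mem v)

open Classical in
theorem le_qIndex_Snk {n k : ℕ} (hk : 1 ≤ k) (hn : 7 * k ^ 2 ≤ n) :
    (n : ℝ) + 2 * k - 2 - 2 * (k - 1) / (7 * k) ≤ qIndex (Snk n k) := by
  have hkn : k ≤ n := by nlinarith
  have hk' : (1 : ℝ) ≤ k := by exact_mod_cast hk
  have hn' : 7 * (k : ℝ) ^ 2 ≤ n := by exact_mod_cast hn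
  set δ : ℝ := 2 * (k - 1) / (7 * k) with hδ
  have hδk : δ * (7 * k) = 2 * (k - 1) := by
    rw [hδ]
    field_simp
  have hδ0 : 0 ≤ δ := by
    rw [hδ]
    apply div_nonneg <;> linarith
  have hδ1 : δ ≤ 2 * (k - 1) := by nlinarith
  set l : ℝ := (n : ℝ) + 2 * k - 2 - δ with hl
  have hlk : 0 < l - k := by nlinarith
  have hδl : 2 * k * (k - 1) ≤ δ * l := by
    have : δ * (7 * k ^ 2) ≤ δ * l := by
      refine mul_le_mul_of_nonneg_left ?_ hδ0
      linarith
    nlinarith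
  set x : Fin n → ℝ := fun v => if (v : ℕ) < k then l - k else k with hx
  have hcard : (Finset.univ.filter fun v : Fin n => (v : ℕ) < k).card = k := by
    rw [Fin.card_filter_val_lt]
    omega
  have hsum : ∀ a b : ℝ, ∑ v : Fin n, (if (v : ℕ) < k then a else b) = k * a + (n - k) * b := by
    intro a b
    have h1 : ∀ v : Fin n, (if (v : ℕ) < k then a else b) =
        b + if (v : ℕ) < k then a - b else 0 := fun v => by split_ifs <;> ring
    simp only [h1]
    rw [Finset.sum_add_distrib, ← Finset.sum_filter, Finset.sum_const, Finset.sum_const, hcard,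
      Finset.card_univ, Fintype.card_fin, nsmul_eq_mul, nsmul_eq_mul]
    ring
  have hadj : ∀ u v : Fin n, (Snk n k).Adj u v ↔ u ≠ v ∧ ((u : ℕ) < k ∨ (v : ℕ) < k) := by
    intro u v
    rw [Snk, SimpleGraph.fromRel_adj]
    tauto
  refine le_qIndex_of_subinvariant _ x l (fun v => ?_) (fun h => ?_) (fun v => ?_)
  · simp only [hx]
    split_ifs <;> linarith
  · have h1 := congrFun h ⟨0, by omega⟩
    simp only [hx, Pi.zero_apply] at h1
    rw [if_pos (show 0 < k from hk)] at h1
    linarith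
  · rw [signlessLaplacian_mulVec_apply, deg_eq_card_filter, Finset.card_filter]
    push_cast
    by_cases hv : (v : ℕ) < k
    · have key : ∀ f : Fin n → ℝ, ∑ u, (if (Snk n k).Adj v u then f u else 0) = ∑ u, f u - f v := by
        intro f
        rw [← Finset.sum_erase_eq_sub (Finset.mem_univ v), ← Finset.sum_filter]
        refine Finset.sum_congr ?_ fun _ _ => rfl
        ext u
        simp [hadj, hv, eq_comm]
      rw [key, key x]
      have hs : ∑ u, x u = k * (l - k) + (n - k) * k := hsum _ _
      have hxv : x v = l - k := if_pos hv
      rw [hs, hxv]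
      simp only [Finset.sum_const, Finset.card_univ, Fintype.card_fin, nsmul_eq_mul, mul_one]
      have hnl : (n : ℝ) = l - 2 * k + 2 + δ := by rw [hl]; ring
      rw [hnl]
      nlinarith
    · have key : ∀ f : Fin n → ℝ, ∑ u, (if (Snk n k).Adj v u then f u else 0) =
          ∑ u : Fin n, if (u : ℕ) < k then f u else 0 := by
        intro f
        refine Finset.sum_congr rfl fun u _ => ?_
        refine if_congr ?_ rfl rfl
        rw [hadj]
        constructor
        · tauto
        · exact fun h => ⟨fun h1 => hv (h1 ▸ h), Or.inr h⟩
      rw [key, key x, hsum]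
      have hs : ∑ u : Fin n, (if (u : ℕ) < k then x u else 0) = k * (l - k) := by
        have h1 := hsum (l - k) 0
        rw [mul_zero, add_zero] at h1
        rw [← h1]
        refine Finset.sum_congr rfl fun u _ => ?_
        split_ifs with hu
        · exact if_pos hu
        · rfl
      have hxv : x v = k := if_neg hv
      rw [hs, hxv]
      linarith

end Comparison

section HighDegree

theorem sum_bound_lt_of_card_le {n k q δ t m : ℝ} (hk : 2 ≤ k) (hn : 7 * k ^ 2 ≤ n)
    (hδ0 : 0 ≤ δ) (hδ : δ * (7 * k) ≤ 2 * (k - 1)) (hq : q = n + 2 * k - 2 - δ)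
    (htm : t = k - 1 ∧ m = n - 1 ∨ t = k ∧ m = n - 2) :
    2 / (2 * q + 3 - n - 2 * k) * (2 * k * n) +
      t * (m * (1 / (q + 1 - m) - 2 / (2 * q + 3 - n - 2 * k))) < q / 2 := by
  have hδ1 : δ ≤ 2 / 7 := by nlinarith
  have hδ2 : δ * n ≤ n * (2 / 7) := by nlinarith
  have hnk : δ * (7 * k ^ 2) ≤ 2 * (k - 1) * k := by nlinarith
  have hα : 0 < 2 * q + 3 - n - 2 * k := by rw [hq]; nlinarith
  have hmain : ∀ s : ℝ, 2 * (2 * k * n - t * m) ≤ s * (2 * q + 3 - n - 2 * k) →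
      s + t * m / (q + 1 - m) < q / 2 → 2 / (2 * q + 3 - n - 2 * k) * (2 * k * n) +
      t * (m * (1 / (q + 1 - m) - 2 / (2 * q + 3 - n - 2 * k))) < q / 2 := by
    intro s h1 h2
    rw [← div_le_iff₀ hα] at h1
    refine lt_of_eq_of_lt ?_ (lt_of_le_of_lt (add_le_add_left h1 _) h2)
    ring
  have hprod : 0 ≤ (n - 7 * k ^ 2) * (1 - δ) := mul_nonneg (by linarith) (by linarith)
  rcases htm with ⟨rfl, rfl⟩ | ⟨rfl, rfl⟩
  · refine hmain (2 * (k + 1)) ?_ ?_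
    · rw [hq]
      nlinarith
    · have hp : 0 < q + 1 - (n - 1) := by rw [hq]; nlinarith
      rw [← lt_sub_iff_add_lt', div_lt_iff₀ hp, hq]
      nlinarith
  · refine hmain (2 * t) ?_ ?_
    · rw [hq]
      nlinarith
    · have hp : 0 < q + 1 - (n - 2) := by rw [hq]; nlinarith
      rw [← lt_sub_iff_add_lt', div_lt_iff₀ hp, hq]
      nlinarith

open Classical in
/-- Splitting the sum over degrees according to whether a degree is large. -/
theorem sum_deg_div_le {V : Type*} [Fintype V] {G : SimpleGraph V} {k : ℕ}
    (hG : ¬HasPathOn G (2 * k + 2)) {q m t : ℝ}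
    (hkq : (Fintype.card V : ℝ) + 2 * k ≤ 2 * m + 1)
    (hm0 : 0 ≤ m) (hmq : m ≤ q) (T : Finset V)
    (hT : ∀ v, v ∈ T ↔ Fintype.card V + 2 * k ≤ 2 * deg G v)
    (hcard : (T.card : ℝ) ≤ t) (hm : ∀ v ∈ T, (deg G v : ℝ) ≤ m) :
    ∑ v, (deg G v : ℝ) / (q + 1 - deg G v) ≤
      2 / (2 * q + 3 - Fintype.card V - 2 * k) * (2 * k * Fintype.card V) +
      t * (m * (1 / (q + 1 - m) - 2 / (2 * q + 3 - Fintype.card V - 2 * k))) := by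
  set n : ℝ := (Fintype.card V : ℝ) with hn
  have hd : 0 < 2 * q + 3 - n - 2 * k := by linarith
  have hmα : 2 / (2 * q + 3 - n - 2 * k) ≤ 1 / (q + 1 - m) := by
    rw [div_le_div_iff₀ hd (by linarith)]
    linarith
  set α := 2 / (2 * q + 3 - n - 2 * k) with hα
  have hα0 : 0 < α := by positivity
  set M := m * (1 / (q + 1 - m) - α) with hM
  have hM0 : 0 ≤ M := mul_nonneg hm0 (by linarith)
  have hv : ∀ v, (deg G v : ℝ) / (q + 1 - deg G v) ≤ α * deg G v + if v ∈ T then M else 0 := by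
    intro v
    set d : ℝ := (deg G v : ℝ) with hdv
    have hd0 : 0 ≤ d := by positivity
    split_ifs with hvT
    · have hdm := hm v hvT
      have h1 : 1 / (q + 1 - d) ≤ 1 / (q + 1 - m) :=
        one_div_le_one_div_of_le (by linarith) (by linarith)
      have h2 : d * (1 / (q + 1 - d) - α) ≤ M :=
        (mul_le_mul_of_nonneg_left (by linarith) hd0).trans
          (mul_le_mul_of_nonneg_right hdm (by linarith))
      rw [div_eq_mul_one_div]
      linarith
    · have hlt : 2 * deg G v + 1 ≤ Fintype.card V + 2 * k := by
        rw [hT] at hvT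
        omega
      have hlt' : 2 * d + 1 ≤ n + 2 * k := by rw [hdv, hn]; exact_mod_cast hlt
      have h1 : 1 / (q + 1 - d) ≤ α := by
        rw [hα, div_le_div_iff₀ (by linarith) hd]
        linarith
      rw [div_eq_mul_one_div, add_zero, mul_comm α]
      exact mul_le_mul_of_nonneg_left h1 hd0
  have hsum : ∑ v, (deg G v : ℝ) ≤ 2 * k * n := by rw [hn]; exact_mod_cast sum_deg_le hG
  calc _ ≤ ∑ v, (α * deg G v + if v ∈ T then M else 0) := Finset.sum_le_sum fun v _ => hv v
    _ = α * ∑ v, (deg G v : ℝ) + T.card * M := by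
      rw [Finset.sum_add_distrib, Finset.mul_sum, ← Finset.sum_filter, Finset.sum_const,
        nsmul_eq_mul, Finset.filter_univ_mem]
    _ ≤ _ := add_le_add (mul_le_mul_of_nonneg_left hsum hα0.le)
      (mul_le_mul_of_nonneg_right hcard hM0)

end HighDegree

section Structure

open Classical in
theorem exists_deg_eq_of_not_hasPathOn_four {n : ℕ} (hn : 7 ≤ n) {G : SimpleGraph (Fin n)}
    (hG : ¬HasPathOn G 4) (hq : (n : ℝ) ≤ qIndex G) : ∃ w, n - 1 ≤ deg G w := by
  by_contra hcon
  push Not at hcon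
  have : Nonempty (Fin n) := ⟨⟨0, by omega⟩⟩
  have hn' : (7 : ℝ) ≤ n := by exact_mod_cast hn
  obtain ⟨x, hx, hx0, hsub⟩ := exists_qIndex_subinvariant G
  obtain ⟨u, hu⟩ := Finite.exists_max x
  have hxu : 0 < x u := by
    obtain ⟨v, hv⟩ := Function.ne_iff.1 hx0
    exact (lt_of_le_of_ne (hx v) (Ne.symm hv)).trans_le (hu v)
  have hsum : ∀ v c, (∀ w, G.Adj v w → x w ≤ c) →
      (∑ w, if G.Adj v w then x w else 0) ≤ deg G v * c := by
    intro v c h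
    rw [← Finset.sum_filter, deg_eq_card_filter, ← nsmul_eq_mul]
    exact Finset.sum_le_card_nsmul _ _ _ fun w hw => h w (Finset.mem_filter.1 hw).2
  have hnx : ∀ v, (n : ℝ) * x v ≤ qIndex G * x v := fun v =>
    mul_le_mul_of_nonneg_right hq (hx v)
  have hdeg4 : 4 ≤ deg G u := by
    by_contra h
    have h1 : (deg G u : ℝ) ≤ 3 := by exact_mod_cast (by omega : deg G u ≤ 3)
    have h2 := hsum u (x u) fun w _ => hu w
    have h3 : (deg G u : ℝ) * x u ≤ 3 * x u := mul_le_mul_of_nonneg_right h1 hxu.le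
    nlinarith [hsub u, hnx u]
  have hleaf : ∀ v, G.Adj u v → ∀ w, G.Adj v w → w = u := by
    intro v huv w hvw
    by_contra hwu
    obtain ⟨c, hcN, hc⟩ := Finset.exists_mem_notMem_of_card_lt_card
      (s := {v, w}) (t := Finset.univ.filter (fun y => G.Adj u y)) (by
        have := Finset.card_le_two (a := v) (b := w)
        rw [deg_eq_card_filter] at hdeg4
        omega)
    have huc : G.Adj u c := (Finset.mem_filter.1 hcN).2
    simp only [Finset.mem_insert, Finset.mem_singleton, not_or] at hc
    refine hG (hasPathOn_of_isChain (l := [c, u, v, w]) ?_ ?_ (by omega) le_rfl)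
    · simp [huc.symm, huv, hvw]
    · simp [huc.ne', hc.1, hc.2, huv.ne, Ne.symm hwu, hvw.ne]
  have hleafx : ∀ v, G.Adj u v → x v ≤ x u / (n - 1) := by
    intro v huv
    have hdv : deg G v ≤ 1 := by
      rw [deg_eq_card_filter]
      refine Finset.card_le_one.2 fun a ha b hb => ?_
      rw [hleaf v huv a (Finset.mem_filter.1 ha).2, hleaf v huv b (Finset.mem_filter.1 hb).2]
    have hdv' : (deg G v : ℝ) ≤ 1 := by exact_mod_cast hdv
    have h2 := hsum v (x u) fun w _ => hu w
    have h3 := mul_le_mul_of_nonneg_right hdv' hxu.le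
    have h4 := mul_le_mul_of_nonneg_right hdv' (hx v)
    rw [le_div_iff₀ (by linarith)]
    nlinarith [hsub v, hnx v]
  have h1 := hsum u _ hleafx
  have hd : (deg G u : ℝ) ≤ n - 2 := by
    have : deg G u + 2 ≤ n := by
      have := hcon u
      omega
    rw [le_sub_iff_add_le]
    exact_mod_cast this
  have h2 : (deg G u : ℝ) * (x u / (n - 1)) < 2 * x u := by
    rw [← mul_div_assoc, div_lt_iff₀ (by linarith)]
    nlinarith
  have h3 := mul_le_mul_of_nonneg_right hd hxu.le
  nlinarith [hsub u, hnx u]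

/-- In a `P_{2k+2}`-free graph, `k` vertices of large degree, one of them dominating, cover all
edges. -/
theorem mem_or_mem_of_adj_of_large_deg {n k : ℕ} (hn : 2 * k + 2 ≤ n) {G : SimpleGraph (Fin n)}
    (hG : ¬HasPathOn G (2 * k + 2)) {K : Finset (Fin n)} (hK : K.card = k) {w : Fin n}
    (hw : w ∈ K) (hwd : n - 1 ≤ deg G w) (hdeg : ∀ t ∈ K, n + 2 * k ≤ 2 * deg G t)
    {u v : Fin n} (huv : G.Adj u v) : u ∈ K ∨ v ∈ K := by
  classical
  by_contra! h
  have hwv : G.Adj w v := by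
    have hsub : (Finset.univ.filter (fun y => G.Adj w y)) = Finset.univ.erase w := by
      refine Finset.eq_of_subset_of_card_le (fun y hy => ?_) ?_
      · exact Finset.mem_erase.2 ⟨(Finset.mem_filter.1 hy).2.ne', Finset.mem_univ y⟩
      · rw [Finset.card_erase_of_mem (Finset.mem_univ w), Finset.card_univ, Fintype.card_fin,
          ← deg_eq_card_filter]
        exact hwd
    have : v ∈ Finset.univ.erase w :=
      Finset.mem_erase.2 ⟨fun e => h.2 (e ▸ hw), Finset.mem_univ v⟩
    rw [← hsub] at this
    exact (Finset.mem_filter.1 this).2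
  have hkpos : 0 < K.card := Finset.card_pos.2 ⟨w, hw⟩
  have hlen : (K.erase w).toList.length = k - 1 := by
    rw [Finset.length_toList, Finset.card_erase_of_mem hw, hK]
  obtain ⟨l, hc, hnd, hl⟩ := exists_alternating_path (G := G) (k := k) (by simpa using hn)
    (K.erase w).toList w [v, u]
    (by simp [hwv, huv.symm])
    (by
      have hnd := Finset.nodup_toList (K.erase w)
      simp only [List.cons_append, List.nil_append, List.nodup_cons, List.mem_cons,
        Finset.mem_toList, Finset.mem_erase]
      refine ⟨?_, ?_, ?_, hnd⟩
      · rintro (e | e | e)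
        · exact h.2 (e ▸ hw)
        · exact h.1 (e ▸ hw)
        · exact e.1 rfl
      · rintro (e | e)
        · exact huv.ne' e
        · exact h.2 e.2
      · exact fun e => h.1 e.2)
    (by
      intro t ht
      rw [Fintype.card_fin]
      rcases List.mem_cons.1 ht with rfl | ht
      · exact hdeg _ hw
      · exact hdeg t (Finset.mem_of_mem_erase (Finset.mem_toList.1 ht)))
    (by
      simp only [List.length_cons, List.length_nil, hlen]
      omega)
  simp only [List.length_cons, List.length_nil, hlen] at hl
  exact hG (hasPathOn_of_isChain hc hnd (by omega) (by omega))

theorem card_le_of_large_deg {n k : ℕ} (hn : 2 * k + 2 ≤ n) {G : SimpleGraph (Fin n)}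
    (hG : ¬HasPathOn G (2 * k + 2)) {T : Finset (Fin n)}
    (hdeg : ∀ t ∈ T, n + 2 * k ≤ 2 * deg G t) : T.card ≤ k := by
  by_contra! h
  obtain ⟨S, hST, hS⟩ := Finset.exists_subset_card_eq (Nat.succ_le_of_lt h)
  obtain ⟨b, rest, hbr⟩ : ∃ b rest, S.toList = b :: rest := by
    refine List.exists_cons_of_ne_nil fun e => ?_
    have := Finset.length_toList S
    rw [e, hS] at this
    simp at this
  have hlen : rest.length = k := by
    have := Finset.length_toList S
    rw [hbr, hS] at this
    simpa using this
  obtain ⟨l, hc, hnd, hl⟩ := exists_alternating_path (G := G) (k := k) (by simpa using hn)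
    rest b [] (List.isChain_singleton b)
    (by
      rw [List.nil_append, ← hbr]
      exact Finset.nodup_toList S)
    (fun t ht => by
      rw [← hbr, Finset.mem_toList] at ht
      rw [Fintype.card_fin]
      exact hdeg t (hST ht))
    (by simp [hlen])
  rw [List.length_nil, hlen] at hl
  exact hG (hasPathOn_of_isChain hc hnd (by omega) (by omega))

theorem exists_dominating_core {n k : ℕ} (hk : 1 ≤ k) (hn : 7 * k ^ 2 ≤ n)
    {G : SimpleGraph (Fin n)} (hG : ¬HasPathOn G (2 * k + 2))
    (hq : (n : ℝ) + 2 * k - 2 - 2 * (k - 1) / (7 * k) ≤ qIndex G) :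
    ∃ K : Finset (Fin n), K.card = k ∧ (∃ w ∈ K, n - 1 ≤ deg G w) ∧
      ∀ t ∈ K, n + 2 * k ≤ 2 * deg G t := by
  classical
  rcases hk.eq_or_lt with rfl | hk2
  · obtain ⟨w, hw⟩ := exists_deg_eq_of_not_hasPathOn_four (by omega) hG (by
      refine le_trans (le_of_eq ?_) hq
      norm_num)
    refine ⟨{w}, Finset.card_singleton w, ⟨w, Finset.mem_singleton_self w, hw⟩, fun t ht => ?_⟩
    rw [Finset.mem_singleton.1 ht]
    omega
  have hn0 : 2 * k + 2 ≤ n := by nlinarith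
  have hne : Nonempty (Fin n) := ⟨⟨0, by omega⟩⟩
  have hk' : (2 : ℝ) ≤ k := by exact_mod_cast hk2
  have hn' : 7 * (k : ℝ) ^ 2 ≤ n := by exact_mod_cast hn
  set δ : ℝ := 2 * (k - 1) / (7 * k) with hδ
  have hδk : δ * (7 * k) = 2 * (k - 1) := by
    rw [hδ]
    field_simp
  have hδ0 : 0 ≤ δ := by
    rw [hδ]
    apply div_nonneg <;> linarith
  have hδ1 : δ ≤ 1 := by nlinarith
  set q : ℝ := (n : ℝ) + 2 * k - 2 - δ with hqdef
  have hcard : (Fintype.card (Fin n) : ℝ) = n := by rw [Fintype.card_fin]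
  have hnq : (n : ℝ) ≤ q := by linarith
  have hhalf := half_qIndex_le_sum G q hq (by rw [hcard]; exact hnq)
  set T : Finset (Fin n) := Finset.univ.filter (fun v => n + 2 * k ≤ 2 * deg G v) with hT
  have hTdeg : ∀ t ∈ T, n + 2 * k ≤ 2 * deg G t := fun t ht => (Finset.mem_filter.1 ht).2
  have hTk : T.card ≤ k := card_le_of_large_deg hn0 hG hTdeg
  have hdegn : ∀ v, deg G v ≤ n - 1 := by
    intro v
    rw [deg_eq_card_filter]
    have : Finset.univ.filter (fun u => G.Adj v u) ⊆ Finset.univ.erase v := fun u hu =>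
      Finset.mem_erase.2 ⟨(Finset.mem_filter.1 hu).2.ne', Finset.mem_univ u⟩
    refine (Finset.card_le_card this).trans ?_
    rw [Finset.card_erase_of_mem (Finset.mem_univ v), Finset.card_univ, Fintype.card_fin]
  have hcontra : ∀ t m : ℝ, (t = k - 1 ∧ m = n - 1 ∨ t = k ∧ m = n - 2) → (T.card : ℝ) ≤ t →
      (∀ v ∈ T, (deg G v : ℝ) ≤ m) → False := by
    intro t m htm hTt hTm
    have hmn : (n : ℝ) - 2 ≤ m ∧ m ≤ n := by
      rcases htm with h | h <;> constructor <;> linarith [h.2]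
    have h1 := sum_deg_div_le hG (q := q) (m := m) (t := t)
      (by rw [hcard]; nlinarith) (by nlinarith) (hmn.2.trans hnq) T
      (fun v => by simp [hT]) hTt hTm
    rw [hcard] at h1
    have h2 := sum_bound_lt_of_card_le hk' hn' hδ0 hδk.le hqdef htm
    linarith
  refine ⟨T, ?_, ?_, hTdeg⟩
  · by_contra h
    refine hcontra (k - 1) (n - 1) (Or.inl ⟨rfl, rfl⟩) ?_ fun v _ => ?_
    · rw [le_sub_iff_add_le]
      exact_mod_cast (by omega : T.card + 1 ≤ k)
    · rw [le_sub_iff_add_le]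
      have := hdegn v
      exact_mod_cast (by omega : deg G v + 1 ≤ n)
  · by_contra! h
    refine hcontra k (n - 2) (Or.inr ⟨rfl, rfl⟩) (by exact_mod_cast hTk) fun v hv => ?_
    rw [le_sub_iff_add_le]
    have := h v hv
    exact_mod_cast (by omega : deg G v + 2 ≤ n)

end Structure

/-- Nikiforov–Yuan, Theorem 4(i): if `k ≥ 1`, `n ≥ 7k²` and `q(G) ≥ q(S_{n,k})`,
then `P_{2k+2} ⊆ G` unless `G ≅ S_{n,k}`. -/
theorem stmt_0 (k n : ℕ) (hk : 1 ≤ k) (hn : 7 * k ^ 2 ≤ n) (G : SimpleGraph (Fin n))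
    (hq : qIndex (Snk n k) ≤ qIndex G) :
    HasPathOn G (2 * k + 2) ∨ Nonempty (G ≃g Snk n k) := by
  by_contra! h
  obtain ⟨hG, hiso⟩ := h
  have hn0 : 2 * k + 2 ≤ n := by nlinarith
  obtain ⟨K, hK, ⟨w, hw, hwd⟩, hdeg⟩ :=
    exists_dominating_core hk hn hG ((le_qIndex_Snk hk hn).trans hq)
  refine not_nonempty_iff.2 hiso (nonempty_iso_Snk_of_cover hk (by omega) G hq K hK fun u v huv =>
    mem_or_mem_of_adj_of_large_deg hn0 hG hK hw hwd hdeg huv)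
end

section
/- Let k ≥ 1, n ≥ 7k², and let G be a simple graph of order n. If q(G) ≥ q(S_{n,k}^+), then G contains a path on 2k+3 vertices as a subgraph, unless G is isomorphic to S_{n,k}^+. -/
open Matrix BigOperators

open Classical in
/-- The set of neighbours of a vertex, as a finset. -/
noncomputable def nbr {V : Type*} [Fintype V] (G : SimpleGraph V) (v : V) : Finset V :=
  Finset.univ.filter (G.Adj v)

@[simp]
theorem mem_nbr {V : Type*} [Fintype V] {G : SimpleGraph V} {v w : V} :
    w ∈ nbr G v ↔ G.Adj v w := by
  simp [nbr]

theorem deg_eq_card_nbr {V : Type*} [Fintype V] (G : SimpleGraph V) (v : V) :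
    deg G v = (nbr G v).card := by
  classical
  rw [deg, Nat.card_eq_fintype_card, Fintype.card_subtype]
  congr 1

theorem sum_nbr_comm {V : Type*} [Fintype V] (G : SimpleGraph V) (s t : Finset V)
    [DecidableEq V] (f : V → V → ℝ) :
    ∑ v ∈ s, ∑ w ∈ nbr G v ∩ t, f v w = ∑ w ∈ t, ∑ v ∈ nbr G w ∩ s, f v w := by
  refine Finset.sum_comm' fun v w => ?_
  simp only [Finset.mem_inter, mem_nbr, G.adj_comm v w]
  tauto

/-- The quadratic form of the signless Laplacian, multiplied by two. -/
noncomputable def edgeForm {V : Type*} [Fintype V] (G : SimpleGraph V) (x : V → ℝ) : ℝ :=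
  ∑ v, ∑ w ∈ nbr G v, (x v + x w) ^ 2

theorem signlessLaplacian_mulVec {V : Type*} [Fintype V] [DecidableEq V] (G : SimpleGraph V)
    (x : V → ℝ) (v : V) :
    (signlessLaplacian G *ᵥ x) v = (nbr G v).card * x v + ∑ w ∈ nbr G v, x w := by
  classical
  rw [signlessLaplacian, Matrix.add_mulVec, Pi.add_apply, Matrix.mulVec_diagonal,
    deg_eq_card_nbr, SimpleGraph.adjMatrix_mulVec_apply]
  congr 1
  refine Finset.sum_congr ?_ fun _ _ => rfl
  ext w
  simp

theorem edgeForm_eq {V : Type*} [Fintype V] [DecidableEq V] (G : SimpleGraph V) (x : V → ℝ) :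
    edgeForm G x = 2 * (x ⬝ᵥ (signlessLaplacian G *ᵥ x)) := by
  have h1 : ∑ v, ∑ w ∈ nbr G v, x w ^ 2 = ∑ v, ∑ w ∈ nbr G v, x v ^ 2 := by
    simpa [-Finset.sum_const] using sum_nbr_comm G Finset.univ Finset.univ (fun _ w => x w ^ 2)
  have h2 : edgeForm G x = ∑ v, ∑ w ∈ nbr G v, x v ^ 2 + ∑ v, ∑ w ∈ nbr G v, x w ^ 2
      + 2 * ∑ v, ∑ w ∈ nbr G v, x v * x w := by
    simp only [edgeForm, Finset.mul_sum, ← Finset.sum_add_distrib]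
    refine Finset.sum_congr rfl fun v _ => Finset.sum_congr rfl fun w _ => ?_
    ring
  rw [h2, h1, dotProduct, Finset.mul_sum, Finset.mul_sum, ← Finset.sum_add_distrib,
    ← Finset.sum_add_distrib]
  refine Finset.sum_congr rfl fun v _ => ?_
  rw [signlessLaplacian_mulVec, Finset.sum_const, nsmul_eq_mul, ← Finset.mul_sum]
  ring

theorem posSemidef_qIndex_sub {V : Type*} [Fintype V] [DecidableEq V] (G : SimpleGraph V) :
    (algebraMap ℝ (Matrix V V ℝ) (qIndex G) - signlessLaplacian G).PosSemidef := by
  have hA := signlessLaplacian_isHermitian G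
  have hH : (algebraMap ℝ (Matrix V V ℝ) (qIndex G) - signlessLaplacian G).IsHermitian := by
    refine Matrix.IsHermitian.sub ?_ hA
    rw [Matrix.algebraMap_eq_diagonal]
    exact Matrix.isHermitian_diagonal _
  rw [hH.posSemidef_iff_eigenvalues_nonneg]
  intro i
  have h := hH.eigenvalues_mem_spectrum_real i
  rw [← spectrum.singleton_sub_eq, Set.singleton_sub, hA.spectrum_real_eq_range_eigenvalues] at h
  obtain ⟨_, ⟨j, rfl⟩, h⟩ := h
  rw [← h, Pi.zero_apply, sub_nonneg]
  exact le_ciSup (Set.finite_range _).bddAbove j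

theorem dotProduct_qIndex_sub {V : Type*} [Fintype V] [DecidableEq V] (G : SimpleGraph V)
    (x : V → ℝ) :
    2 * (x ⬝ᵥ ((algebraMap ℝ (Matrix V V ℝ) (qIndex G) - signlessLaplacian G) *ᵥ x))
      = 2 * (qIndex G * ∑ v, x v ^ 2) - edgeForm G x := by
  rw [edgeForm_eq, Matrix.sub_mulVec, dotProduct_sub, Algebra.algebraMap_eq_smul_one,
    Matrix.smul_mulVec, Matrix.one_mulVec, dotProduct_smul, smul_eq_mul, mul_sub]
  simp only [dotProduct, sq]

theorem edgeForm_le {V : Type*} [Fintype V] [DecidableEq V] (G : SimpleGraph V) (x : V → ℝ) :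
    edgeForm G x ≤ 2 * (qIndex G * ∑ v, x v ^ 2) := by
  have h := (posSemidef_qIndex_sub G).dotProduct_mulVec_nonneg x
  have h2 := dotProduct_qIndex_sub G x
  simp only [star_trivial] at h
  linarith

theorem eigen_of_edgeForm_eq {V : Type*} [Fintype V] [DecidableEq V] {G : SimpleGraph V}
    {x : V → ℝ} (hx : edgeForm G x = 2 * (qIndex G * ∑ v, x v ^ 2)) (v : V) :
    qIndex G * x v = (nbr G v).card * x v + ∑ w ∈ nbr G v, x w := by
  have h := ((posSemidef_qIndex_sub G).dotProduct_mulVec_zero_iff x).1 (by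
    have h2 := dotProduct_qIndex_sub G x
    simp only [star_trivial]
    linarith)
  have h' := congrFun h v
  rw [Matrix.sub_mulVec, Pi.sub_apply, signlessLaplacian_mulVec, Algebra.algebraMap_eq_smul_one,
    Matrix.smul_mulVec, Matrix.one_mulVec, Pi.smul_apply, smul_eq_mul, Pi.zero_apply] at h'
  linarith

/-- `x` is a nonnegative eigenvector of the signless Laplacian for the `Q`-index, scaled so that
its largest entry, attained at `u`, is one. -/
structure IsPerron {V : Type*} [Fintype V] [DecidableEq V] (G : SimpleGraph V) (x : V → ℝ)
    (u : V) : Prop where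
  nonneg : ∀ v, 0 ≤ x v
  le_one : ∀ v, x v ≤ 1
  eq_one : x u = 1
  eigen : ∀ v, qIndex G * x v = (nbr G v).card * x v + ∑ w ∈ nbr G v, x w

theorem edgeForm_of_eigen {V : Type*} [Fintype V] [DecidableEq V] {G : SimpleGraph V}
    {x : V → ℝ} {q : ℝ} (h : ∀ v, q * x v = (nbr G v).card * x v + ∑ w ∈ nbr G v, x w) :
    edgeForm G x = 2 * (q * ∑ v, x v ^ 2) := by
  rw [edgeForm_eq, dotProduct, Finset.mul_sum, Finset.mul_sum, Finset.mul_sum]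
  refine Finset.sum_congr rfl fun v _ => ?_
  rw [signlessLaplacian_mulVec, ← h v]
  ring

theorem exists_isPerron {V : Type*} [Fintype V] [DecidableEq V] [Nonempty V]
    (G : SimpleGraph V) : ∃ x u, IsPerron G x u := by
  have hA := signlessLaplacian_isHermitian G
  obtain ⟨i, hi⟩ := exists_eq_ciSup_of_finite (f := hA.eigenvalues)
  set y : V → ℝ := ⇑(hA.eigenvectorBasis i) with hy
  have hQ : signlessLaplacian G *ᵥ y = qIndex G • y := by
    rw [qIndex, ← hi]
    exact hA.mulVec_eigenvectorBasis i
  have hyne : ∃ v, y v ≠ 0 := by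
    by_contra hc
    push Not at hc
    apply hA.eigenvectorBasis.toBasis.ne_zero i
    ext v
    simpa using hc v
  have hform : edgeForm G y = 2 * (qIndex G * ∑ v, y v ^ 2) := by
    apply edgeForm_of_eigen
    intro v
    rw [← signlessLaplacian_mulVec, hQ, Pi.smul_apply, smul_eq_mul]
  have habs : edgeForm G y ≤ edgeForm G (fun v => |y v|) := by
    refine Finset.sum_le_sum fun v _ => Finset.sum_le_sum fun w _ => ?_
    rw [← sq_abs]
    exact pow_le_pow_left₀ (abs_nonneg _) (abs_add_le _ _) 2
  have hle := edgeForm_le G (fun v => |y v|)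
  simp only [sq_abs] at hle
  have heig := eigen_of_edgeForm_eq (G := G) (x := fun v => |y v|) (by
    simp only [sq_abs]
    linarith)
  obtain ⟨u, hu⟩ := Finite.exists_max (fun v => |y v|)
  have hpos : 0 < |y u| := by
    obtain ⟨v, hv⟩ := hyne
    exact (abs_pos.2 hv).trans_le (hu v)
  refine ⟨fun v => |y v| / |y u|, u, fun v => by positivity, fun v => ?_, div_self hpos.ne', ?_⟩
  · exact (div_le_one hpos).2 (hu v)
  · intro v
    rw [← Finset.sum_div, mul_div_assoc', mul_div_assoc', ← add_div, heig v]

theorem qIndex_le_of_iso {V W : Type*} [Fintype V] [DecidableEq V] [Fintype W] [DecidableEq W]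
    [Nonempty V] {G : SimpleGraph V} {H : SimpleGraph W} (e : G ≃g H) :
    qIndex G ≤ qIndex H := by
  obtain ⟨x, u, hx⟩ := exists_isPerron G
  have h1 := edgeForm_of_eigen hx.eigen
  have h2 := edgeForm_le H (x ∘ e.symm)
  have h3 : edgeForm H (x ∘ e.symm) = edgeForm G x := by
    unfold edgeForm
    refine (Fintype.sum_equiv e.toEquiv _ _ fun v => ?_).symm
    refine Finset.sum_bij (fun w _ => e w) ?_ ?_ ?_ ?_
    · intro w hw
      exact mem_nbr.2 (e.map_adj_iff.2 (mem_nbr.1 hw))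
    · intro a _ b _ h
      exact e.injective h
    · intro w hw
      refine ⟨e.symm w, ?_, by simp⟩
      rw [mem_nbr] at hw ⊢
      rw [← e.map_adj_iff]
      simpa using hw
    · intro w _
      simp
  have h4 : ∑ v, (x ∘ e.symm) v ^ 2 = ∑ v, x v ^ 2 :=
    (Fintype.sum_equiv e.toEquiv _ _ fun v => by simp).symm
  have h5 : 0 < ∑ v, x v ^ 2 := by
    refine Finset.sum_pos' (fun v _ => sq_nonneg _) ⟨u, Finset.mem_univ _, ?_⟩
    rw [hx.eq_one]
    norm_num
  rw [h3, h4, h1] at h2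
  nlinarith

theorem qIndex_eq_of_iso {V W : Type*} [Fintype V] [DecidableEq V] [Fintype W] [DecidableEq W]
    [Nonempty V] {G : SimpleGraph V} {H : SimpleGraph W} (e : G ≃g H) :
    qIndex G = qIndex H := by
  have : Nonempty W := Nonempty.map e inferInstance
  exact (qIndex_le_of_iso e).antisymm (qIndex_le_of_iso e.symm)

/-- The vertices of the list are distinct and consecutive ones are adjacent. -/
def IsPathList {V : Type*} (G : SimpleGraph V) (l : List V) : Prop :=
  l.IsChain G.Adj ∧ l.Nodup

theorem IsPathList.hasPathOn {V : Type*} {G : SimpleGraph V} {l : List V} {m : ℕ}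
    (h : IsPathList G l) (hm : m ≤ l.length) (hm0 : 0 < m) : HasPathOn G m := by
  have hlen : (l.take m).length = m := by simpa using hm
  have hne : l.take m ≠ [] := by
    intro h0
    rw [h0] at hlen
    simp at hlen
    omega
  refine ⟨_, _, SimpleGraph.Walk.ofSupport (l.take m) hne (h.1.take m), ?_, ?_⟩
  · rw [SimpleGraph.Walk.isPath_def, SimpleGraph.Walk.support_ofSupport]
    exact h.2.sublist (List.take_sublist _ _)
  · rw [SimpleGraph.Walk.support_ofSupport, hlen]

/-- If the ends of a path have many neighbours on it, then some cycle runs through exactly the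
vertices of the path. -/
theorem exists_cycle_of_path {V : Type*} [Fintype V] [DecidableEq V] {G : SimpleGraph V}
    {W : Finset V} {p : List V} (hp : IsPathList G p) (hne : p ≠ [])
    (ha : ∀ w ∈ W, G.Adj (p.head hne) w → w ∈ p)
    (hb : ∀ w ∈ W, G.Adj (p.getLast hne) w → w ∈ p)
    (hlen : p.length ≤ (nbr G (p.head hne) ∩ W).card + (nbr G (p.getLast hne) ∩ W).card) :
    ∃ c : List V, c.Perm p ∧ c.IsChain G.Adj ∧
      ∀ x ∈ c.getLast?, ∀ y ∈ c.head?, G.Adj x y := by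
  set a := p.head hne with ha'
  set b := p.getLast hne with hb'
  have hpos : 0 < p.length := List.length_pos_iff.2 hne
  set f : ℕ → V := fun i => p.getD i a with hf
  have hfi : ∀ i (h : i < p.length), f i = p[i] := fun i h => by simp [hf, h]
  set A := (Finset.range (p.length - 1)).filter (fun i => f (i + 1) ∈ nbr G a ∩ W) with hA
  set B := (Finset.range (p.length - 1)).filter (fun i => f i ∈ nbr G b ∩ W) with hB
  have hAc : (nbr G a ∩ W).card ≤ A.card := by
    refine (Finset.card_le_card (t := A.image (fun i => f (i + 1))) ?_).trans
      Finset.card_image_le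
    intro w hw
    have hw' := hw
    rw [Finset.mem_inter, mem_nbr] at hw'
    obtain ⟨i, hi, rfl⟩ := List.getElem_of_mem (ha w hw'.2 hw'.1)
    rcases i with _ | i
    · exact absurd (by rw [ha', List.head_eq_getElem]) hw'.1.ne
    · refine Finset.mem_image.2 ⟨i, Finset.mem_filter.2 ⟨Finset.mem_range.2 (by omega), ?_⟩, ?_⟩
      · rwa [hfi _ hi]
      · exact hfi _ hi
  have hBc : (nbr G b ∩ W).card ≤ B.card := by
    refine (Finset.card_le_card (t := B.image f) ?_).trans Finset.card_image_le
    intro w hw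
    have hw' := hw
    rw [Finset.mem_inter, mem_nbr] at hw'
    obtain ⟨i, hi, rfl⟩ := List.getElem_of_mem (hb w hw'.2 hw'.1)
    have hi' : i ≠ p.length - 1 := by
      rintro rfl
      exact absurd (by rw [hb', List.getLast_eq_getElem]) hw'.1.ne
    refine Finset.mem_image.2 ⟨i, Finset.mem_filter.2 ⟨Finset.mem_range.2 (by omega), ?_⟩, ?_⟩
    · rwa [hfi _ hi]
    · exact hfi _ hi
  have hABc : (A ∪ B).card ≤ p.length - 1 := by
    refine (Finset.card_le_card (Finset.union_subset (Finset.filter_subset _ _)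
      (Finset.filter_subset _ _))).trans ?_
    simp
  have hI : 0 < (A ∩ B).card := by
    have := Finset.card_union_add_card_inter A B
    omega
  obtain ⟨i, hi⟩ := Finset.card_pos.1 hI
  rw [Finset.mem_inter, hA, hB, Finset.mem_filter, Finset.mem_filter, Finset.mem_range] at hi
  obtain ⟨⟨hi1, hi2⟩, _, hi3⟩ := hi
  rw [hfi _ (by omega), Finset.mem_inter, mem_nbr] at hi2
  rw [hfi _ (by omega), Finset.mem_inter, mem_nbr] at hi3
  have hdrop : p.drop (i + 1) ≠ [] := by
    rw [Ne, List.drop_eq_nil_iff]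
    omega
  refine ⟨p.take (i + 1) ++ (p.drop (i + 1)).reverse, ?_, ?_, ?_⟩
  · refine ((List.reverse_perm _).append_left _).trans ?_
    rw [List.take_append_drop]
  · refine (hp.1.take _).append ?_ ?_
    · rw [List.isChain_reverse]
      exact (hp.1.drop _).imp fun x y h => h.symm
    · intro x hx y hy
      rw [List.head?_reverse, List.getLast?_drop] at hy
      rw [List.getLast?_take] at hx
      simp only [Nat.add_eq_zero_iff, one_ne_zero, and_false, if_false, Nat.add_sub_cancel] at hx
      rw [if_neg (by omega), List.getLast?_eq_some_getLast hne] at hy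
      rw [List.getElem?_eq_getElem (by omega)] at hx
      simp at hx hy
      rw [← hx, ← hy]
      exact hi3.1.symm
  · intro x hx y hy
    rw [List.getLast?_append_of_ne_nil _ (by simpa using hdrop), List.getLast?_reverse,
      List.head?_drop, List.getElem?_eq_getElem (by omega)] at hx
    rw [List.head?_append_of_ne_nil _ (by simp [hne]), List.head?_take,
      if_neg (by omega), List.head?_eq_some_head hne] at hy
    simp at hx hy
    rw [← hx, ← hy]
    exact hi2.1.symm

/-- A cycle with an edge leaving it can be opened up into a longer path. -/
theorem exists_longer_path {V : Type*} {G : SimpleGraph V} {c : List V}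
    (hc : c.IsChain G.Adj) (hn : c.Nodup)
    (hcl : ∀ x ∈ c.getLast?, ∀ y ∈ c.head?, G.Adj x y) {v w : V} (hv : v ∈ c) (hw : w ∉ c)
    (hvw : G.Adj v w) : ∃ l : List V, IsPathList G l ∧ l.Perm (w :: c) := by
  obtain ⟨s, t, rfl⟩ := List.append_of_mem hv
  have hperm : (w :: (v :: t ++ s)).Perm (w :: (s ++ v :: t)) :=
    List.Perm.cons _ List.perm_append_comm
  refine ⟨w :: (v :: t ++ s), ⟨?_, ?_⟩, hperm⟩
  · rw [List.cons_append, List.isChain_cons_cons]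
    refine ⟨hvw.symm, ?_⟩
    rw [← List.cons_append]
    refine hc.right_of_append.append hc.left_of_append ?_
    intro x hx y hy
    refine hcl x ?_ y ?_
    · rwa [List.getLast?_append_of_ne_nil _ (by simp)]
    · rcases s with _ | ⟨z, s⟩
      · simp at hy
      · simpa using hy
  · exact hperm.nodup_iff.2 (List.nodup_cons.2 ⟨hw, hn⟩)

theorem exists_longest_path {V : Type*} [Fintype V] [DecidableEq V] (G : SimpleGraph V)
    {W : Finset V} (hW : W.Nonempty) : ∃ p : List V, IsPathList G p ∧ (∀ v ∈ p, v ∈ W) ∧ p ≠ [] ∧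
      ∀ l : List V, IsPathList G l → (∀ v ∈ l, v ∈ W) → l.length ≤ p.length := by
  by_contra hcon
  push Not at hcon
  have key : ∀ m : ℕ, ∃ p : List V, IsPathList G p ∧ (∀ v ∈ p, v ∈ W) ∧ m < p.length := by
    intro m
    induction m with
    | zero =>
      obtain ⟨v, hv⟩ := hW
      exact ⟨[v], ⟨List.isChain_singleton v, List.nodup_singleton v⟩, by simpa using hv, by simp⟩
    | succ m ih =>
      obtain ⟨p, hp, hpW, hlt⟩ := ih
      obtain ⟨l, hl, hlW, hll⟩ := hcon p hp hpW (by rintro rfl; simp at hlt)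
      exact ⟨l, hl, hlW, by omega⟩
  obtain ⟨p, hp, hpW, hlt⟩ := key W.card
  have h1 : p.toFinset.card = p.length := List.toFinset_card_of_nodup hp.2
  have h2 : p.toFinset.card ≤ W.card := Finset.card_le_card fun v hv => hpW v (by simpa using hv)
  omega

/-- Erdős–Gallai: a graph without a path on `2k+3` vertices has average degree at most `2k+1`. -/
theorem sum_card_nbr_le {V : Type*} [Fintype V] [DecidableEq V] {G : SimpleGraph V} {k : ℕ}
    (hG : ¬ HasPathOn G (2 * k + 3)) (W : Finset V) :
    ∑ v ∈ W, (nbr G v ∩ W).card ≤ (2 * k + 1) * W.card := by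
  induction W using Finset.strongInduction with
  | H W ih =>
  rcases W.eq_empty_or_nonempty with rfl | hW
  · simp
  by_cases hmin : ∃ v ∈ W, (nbr G v ∩ W).card ≤ k
  · obtain ⟨v, hv, hk⟩ := hmin
    classical
    have h1 := ih (W.erase v) (Finset.erase_ssubset hv)
    have h2 : ∑ w ∈ W.erase v, (nbr G w ∩ W).card
        = ∑ w ∈ W.erase v, (nbr G w ∩ W.erase v).card + (nbr G v ∩ W).card := by
      have h3 : ∀ w ∈ W.erase v, (nbr G w ∩ W).card
          = (nbr G w ∩ W.erase v).card + if G.Adj v w then 1 else 0 := by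
        intro w _
        split_ifs with hvw
        · rw [Finset.inter_erase, Finset.card_erase_add_one]
          simp [hv, hvw.symm]
        · rw [Finset.inter_erase, Finset.erase_eq_of_notMem, add_zero]
          simp [G.adj_comm w v, hvw]
      rw [Finset.sum_congr rfl h3, Finset.sum_add_distrib, ← Finset.card_filter]
      congr 2
      ext w
      simp only [Finset.mem_filter, Finset.mem_erase, Finset.mem_inter, mem_nbr]
      constructor
      · rintro ⟨⟨_, h⟩, h'⟩
        exact ⟨h', h⟩
      · rintro ⟨h, h'⟩
        exact ⟨⟨h.ne', h'⟩, h⟩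
    rw [← Finset.add_sum_erase _ _ hv, h2]
    have h4 := Finset.card_erase_add_one hv
    rw [← h4]
    nlinarith
  · push Not at hmin
    obtain ⟨p, hp, hpW, hne, hmax⟩ := exists_longest_path G hW
    have hlen : p.length ≤ 2 * k + 2 := by
      by_contra hc
      exact hG (hp.hasPathOn (m := 2 * k + 3) (by omega) (by omega))
    have hhead : ∀ w ∈ W, G.Adj (p.head hne) w → w ∈ p := by
      intro w hw hadj
      by_contra hwp
      have := hmax (w :: p) ⟨hp.1.cons_of_ne_nil hne hadj.symm, List.nodup_cons.2 ⟨hwp, hp.2⟩⟩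
        (by simpa [hw] using hpW)
      simp at this
    have hlast : ∀ w ∈ W, G.Adj (p.getLast hne) w → w ∈ p := by
      intro w hw hadj
      by_contra hwp
      have := hmax (p ++ [w]) ⟨hp.1.append (List.isChain_singleton w) (by
        intro x hx y hy
        rw [List.getLast?_eq_some_getLast hne] at hx
        simp at hx hy
        rw [← hx, ← hy]
        exact hadj), by
        rw [List.nodup_append]
        refine ⟨hp.2, List.nodup_singleton w, ?_⟩
        intro x hx y hy
        simp at hy
        rintro rfl
        exact hwp (hy ▸ hx)⟩ (by
        intro v hv
        rcases List.mem_append.1 hv with h | h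
        · exact hpW v h
        · simp at h
          exact h ▸ hw)
      simp at this
    have hh := hmin _ (hpW _ (List.head_mem hne))
    have hl := hmin _ (hpW _ (List.getLast_mem hne))
    obtain ⟨c, hcp, hc, hcl⟩ := exists_cycle_of_path (W := W) hp hne hhead hlast (by omega)
    have hcn : c.Nodup := hcp.nodup_iff.2 hp.2
    have hcW : c.toFinset ⊆ W := fun v hv => hpW v (hcp.mem_iff.1 (by simpa using hv))
    have hclosed : ∀ v ∈ c, ∀ w ∈ W, G.Adj v w → w ∈ c := by
      intro v hv w hw hvw
      by_contra hwc
      obtain ⟨l, hl, hlp⟩ := exists_longer_path hc hcn hcl hv hwc hvw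
      have h1 := hmax l hl (by
        intro x hx
        rcases List.mem_cons.1 (hlp.mem_iff.1 hx) with rfl | h
        · exact hw
        · exact hpW x (hcp.mem_iff.1 h))
      rw [hlp.length_eq, List.length_cons, hcp.length_eq] at h1
      omega
    have hcc : c.toFinset.card ≤ 2 * k + 2 := by
      rw [List.toFinset_card_of_nodup hcn, hcp.length_eq]
      exact hlen
    have hcne : c.toFinset.Nonempty :=
      ⟨p.head hne, by simpa using hcp.mem_iff.2 (List.head_mem hne)⟩
    have h1 := ih (W \ c.toFinset) (Finset.sdiff_ssubset hcW hcne)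
    have h2 : ∀ v ∈ W \ c.toFinset, (nbr G v ∩ W).card = (nbr G v ∩ (W \ c.toFinset)).card := by
      intro v hv
      congr 1
      ext w
      simp only [Finset.mem_inter, mem_nbr, Finset.mem_sdiff, List.mem_toFinset] at hv ⊢
      constructor
      · rintro ⟨h, hw⟩
        exact ⟨h, hw, fun hwc => hv.2 (hclosed w hwc v hv.1 h.symm)⟩
      · rintro ⟨h, hw, _⟩
        exact ⟨h, hw⟩
    have h3 : ∀ v ∈ c.toFinset, (nbr G v ∩ W).card ≤ 2 * k + 1 := by
      intro v hv
      have : nbr G v ∩ W ⊆ c.toFinset.erase v := by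
        intro w hw
        rw [Finset.mem_inter, mem_nbr] at hw
        rw [Finset.mem_erase]
        exact ⟨hw.1.ne', by simpa using hclosed v (by simpa using hv) w hw.2 hw.1⟩
      have h5 := Finset.card_le_card this
      rw [Finset.card_erase_of_mem hv] at h5
      omega
    rw [← Finset.sum_sdiff hcW, Finset.sum_congr rfl h2]
    have h4 := Finset.sum_le_card_nsmul _ _ _ h3
    have h5 := Finset.card_sdiff_add_card_eq_card hcW
    rw [← h5, smul_eq_mul] at *
    nlinarith

/-- Every vertex of `H` is joined to all other vertices, and the only other edge is `ab`. -/
def joinPlus {V : Type*} (H : Finset V) (a b : V) : SimpleGraph V where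
  Adj i j := i ≠ j ∧ (i ∈ H ∨ j ∈ H ∨ (i = a ∧ j = b) ∨ (i = b ∧ j = a))
  symm := ⟨fun i j h => by tauto⟩
  loopless := ⟨fun i h => h.1 rfl⟩

theorem exists_iso_joinPlus {k n : ℕ} {H : Finset (Fin n)} (hH : H.card = k) {a b : Fin n}
    (ha : a ∉ H) (hb : b ∉ H) (hab : a ≠ b) : Nonempty (joinPlus H a b ≃g SnkPlus n k) := by
  set C : Finset (Fin n) := (insert a (insert b H))ᶜ with hC
  set l : List (Fin n) := H.toList ++ (a :: b :: C.toList) with hl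
  have hnd : l.Nodup := by
    simp only [hl, hC, List.nodup_append, List.nodup_cons, Finset.nodup_toList, List.mem_cons,
      Finset.mem_toList, Finset.mem_compl, Finset.mem_insert]
    refine ⟨trivial, ⟨by tauto, by tauto, trivial⟩, ?_⟩
    rintro x hx y hy rfl
    rcases hy with rfl | rfl | hy <;> tauto
  have hmem : ∀ v, v ∈ l := by
    intro v
    simp only [hl, hC, List.mem_append, List.mem_cons, Finset.mem_toList, Finset.mem_compl,
      Finset.mem_insert]
    tauto
  have hlen : n = l.length := by
    rw [← List.toFinset_card_of_nodup hnd]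
    have : l.toFinset = Finset.univ := by
      ext v
      simpa using hmem v
    rw [this, Finset.card_univ, Fintype.card_fin]
  set e : Fin n ≃ Fin n := (finCongr hlen).trans (hnd.getEquivOfForallMemList l hmem) with he
  have hel : ∀ i : Fin n, e i = l[(i : ℕ)]'(hlen ▸ i.2) := fun i => rfl
  have hHl : H.toList.length = k := by rw [Finset.length_toList, hH]
  have h1 : ∀ i : Fin n, e i ∈ H ↔ (i : ℕ) < k := by
    intro i
    rw [hel]
    by_cases h : (i : ℕ) < k
    · have : l[(i : ℕ)]'(hlen ▸ i.2) = H.toList[(i : ℕ)]'(by omega) :=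
        List.getElem_append_left (by omega)
      rw [this]
      exact iff_of_true (Finset.mem_toList.1 (List.getElem_mem _)) h
    · have hi : (i : ℕ) - H.toList.length < (a :: b :: C.toList).length := by
        have h' : (i : ℕ) < l.length := hlen.subst i.2
        rw [hl, List.length_append] at h'
        omega
      have h2 : l[(i : ℕ)]'(hlen ▸ i.2) = (a :: b :: C.toList)[(i : ℕ) - H.toList.length] :=
        List.getElem_append_right (by omega)
      have h3 := List.getElem_mem hi
      rw [← h2] at h3
      refine iff_of_false (fun h4 => ?_) h
      simp only [List.mem_cons, Finset.mem_toList, hC, Finset.mem_compl, Finset.mem_insert] at h3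
      rcases h3 with h3 | h3 | h3
      · exact ha (h3 ▸ h4)
      · exact hb (h3 ▸ h4)
      · tauto
  have hlk : k + 2 ≤ n := by
    rw [hlen, hl, List.length_append, hHl]
    simp
  have h2 : e ⟨k, by omega⟩ = a := by
    rw [hel]
    simp [hl, hHl]
  have h3 : e ⟨k + 1, by omega⟩ = b := by
    rw [hel]
    simp [hl, hHl]
  have h4 : ∀ i : Fin n, e i = a ↔ (i : ℕ) = k := fun i => by
    rw [← h2, e.injective.eq_iff, Fin.ext_iff]
  have h5 : ∀ i : Fin n, e i = b ↔ (i : ℕ) = k + 1 := fun i => by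
    rw [← h3, e.injective.eq_iff, Fin.ext_iff]
  refine ⟨RelIso.symm ⟨e, ?_⟩⟩
  intro i j
  simp only [joinPlus, SnkPlus, SimpleGraph.fromRel_adj, h1, h4, h5, ne_eq, e.injective.eq_iff]
  tauto

/-- A subgraph of `joinPlus H a b` whose `Q`-index is at least as large is the whole graph. -/
theorem iso_of_le_joinPlus {k n : ℕ} (hk : 1 ≤ k) {G : SimpleGraph (Fin n)}
    {H : Finset (Fin n)} (hH : H.card = k) {a b : Fin n} (ha : a ∉ H) (hb : b ∉ H) (hab : a ≠ b)
    (hle : ∀ i j, G.Adj i j → (joinPlus H a b).Adj i j)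
    (hq : qIndex (SnkPlus n k) ≤ qIndex G) : Nonempty (G ≃g SnkPlus n k) := by
  have : Nonempty (Fin n) := ⟨a⟩
  obtain ⟨e⟩ := exists_iso_joinPlus hH ha hb hab
  rw [← qIndex_eq_of_iso e] at hq
  obtain ⟨x, u, hx⟩ := exists_isPerron G
  have hsub : ∀ v, nbr G v ⊆ nbr (joinPlus H a b) v := fun v w hw =>
    mem_nbr.2 (hle _ _ (mem_nbr.1 hw))
  have hrow : ∀ v, ∑ w ∈ nbr G v, (x v + x w) ^ 2
      ≤ ∑ w ∈ nbr (joinPlus H a b) v, (x v + x w) ^ 2 := fun v =>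
    Finset.sum_le_sum_of_subset_of_nonneg (hsub v) fun _ _ _ => sq_nonneg _
  have h1 : edgeForm G x ≤ edgeForm (joinPlus H a b) x := Finset.sum_le_sum fun v _ => hrow v
  have h2 := edgeForm_of_eigen hx.eigen
  have h3 := edgeForm_le (joinPlus H a b) x
  have h4 : 0 < ∑ v, x v ^ 2 := by
    refine Finset.sum_pos' (fun v _ => sq_nonneg _) ⟨u, Finset.mem_univ _, ?_⟩
    rw [hx.eq_one]
    norm_num
  have h5 := mul_le_mul_of_nonneg_right hq h4.le
  have h6 := eigen_of_edgeForm_eq (G := joinPlus H a b) (x := x) (by linarith)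
  obtain ⟨h, hh⟩ : H.Nonempty := Finset.card_pos.1 (by omega)
  have hadj : ∀ v, v ≠ h → (joinPlus H a b).Adj h v := fun v hv => ⟨hv.symm, Or.inl hh⟩
  have hpos : ∀ v, 0 < x v := by
    have key : ∀ v w, 0 < x v → (joinPlus H a b).Adj w v → 0 < x w := by
      intro v w hv hvw
      refine lt_of_le_of_ne (hx.nonneg w) fun h0 => ?_
      have h7 := h6 w
      rw [← h0, mul_zero, mul_zero, zero_add] at h7
      have h8 := Finset.single_le_sum (f := x) (fun i _ => hx.nonneg i) (mem_nbr.2 hvw)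
      linarith
    have hu : 0 < x u := by
      rw [hx.eq_one]
      norm_num
    have hxh : 0 < x h := by
      by_cases h7 : u = h
      · rwa [← h7]
      · exact key u h hu (hadj u h7)
    intro v
    by_cases h7 : v = h
    · rwa [h7]
    · exact key h v hxh (hadj v h7).symm
  have h7 : edgeForm G x = edgeForm (joinPlus H a b) x := by linarith
  have h8 : ∀ i j, (joinPlus H a b).Adj i j → G.Adj i j := by
    intro i j hij
    by_contra hG
    have h9 := (Finset.sum_eq_sum_iff_of_le fun v _ => hrow v).1 h7 i (Finset.mem_univ i)
    have h10 : ∑ w ∈ nbr G i, (x i + x w) ^ 2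
        < ∑ w ∈ nbr (joinPlus H a b) i, (x i + x w) ^ 2 := by
      refine Finset.sum_lt_sum_of_subset (hsub i) (mem_nbr.2 hij) (by simpa using hG) ?_
        fun _ _ _ => sq_nonneg _
      have := hpos i
      have := hpos j
      positivity
    linarith
  have h9 : G = joinPlus H a b := by
    ext i j
    exact ⟨hle i j, h8 i j⟩
  rw [h9]
  exact ⟨e⟩

theorem qIndex_SnkPlus_mul_ge {n k : ℕ} (hkn : k + 2 ≤ n) (t : ℝ) :
    2 * k * (k - 1) + k * (n - k) * (1 + t) ^ 2 + 2 * t ^ 2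
      ≤ qIndex (SnkPlus n k) * (k + (n - k) * t ^ 2) := by
  set H : Finset (Fin n) := Finset.univ.filter (fun i => (i : ℕ) < k) with hH
  have hHc : H.card = k := by
    rw [hH, Fin.card_filter_val_lt, min_eq_right (by omega)]
  set x : Fin n → ℝ := fun i => if i ∈ H then 1 else t with hx
  have hsplit : ∀ f : Fin n → ℝ, ∑ i, f i = ∑ i ∈ H, f i + ∑ i ∈ Hᶜ, f i := fun f =>
    (Finset.sum_add_sum_compl H f).symm
  have hcc : ((Hᶜ.card : ℕ) : ℝ) = n - k := by
    rw [Finset.card_compl, Fintype.card_fin, hHc, Nat.cast_sub (by omega)]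
  have hnorm : ∑ i, x i ^ 2 = k + (n - k) * t ^ 2 := by
    rw [hsplit, Finset.sum_congr rfl (g := fun _ => (1 : ℝ)) fun i hi => by simp [hx, hi],
      Finset.sum_congr (s₁ := Hᶜ) rfl (g := fun _ => t ^ 2) fun i hi => by
        simp [hx, Finset.mem_compl.1 hi]]
    simp [hHc, hcc]
  have hin : ∀ v ∈ H, ∑ w ∈ nbr (SnkPlus n k) v, (x v + x w) ^ 2
      = 4 * (k - 1) + (n - k) * (1 + t) ^ 2 := by
    intro v hv
    have h1 : nbr (SnkPlus n k) v = Finset.univ.erase v := by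
      ext w
      have : (v : ℕ) < k := by simpa [hH] using hv
      simp [SnkPlus, this, eq_comm]
    have h2 := Finset.add_sum_erase Finset.univ (fun w => (x v + x w) ^ 2) (Finset.mem_univ v)
    rw [h1]
    rw [hsplit, Finset.sum_congr (s₁ := H) rfl (g := fun _ => (4 : ℝ)) fun i hi => by
        simp only [hx, hi, hv, if_true]
        norm_num,
      Finset.sum_congr (s₁ := Hᶜ) rfl (g := fun _ => (1 + t) ^ 2) fun i hi => by
        simp [hx, hv, Finset.mem_compl.1 hi]] at h2
    simp only [hx, hv, if_true, Finset.sum_const, nsmul_eq_mul, hHc, hcc] at h2 ⊢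
    linarith
  have hout : ∀ v ∈ Hᶜ, k * (1 + t) ^ 2 ≤ ∑ w ∈ nbr (SnkPlus n k) v, (x v + x w) ^ 2 := by
    intro v hv
    have hv' := Finset.mem_compl.1 hv
    have h1 : H ⊆ nbr (SnkPlus n k) v := by
      intro w hw
      have : (w : ℕ) < k := by simpa [hH] using hw
      simp only [mem_nbr, SnkPlus, SimpleGraph.fromRel_adj, this, true_or, or_true, and_true]
      rintro rfl
      exact hv' hw
    refine le_trans (le_of_eq ?_) (Finset.sum_le_sum_of_subset_of_nonneg h1
      fun _ _ _ => sq_nonneg _)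
    rw [Finset.sum_congr rfl (g := fun _ => (1 + t) ^ 2) fun i hi => by
      simp [hx, hi, hv', add_comm]]
    simp [hHc]
  set a : Fin n := ⟨k, by omega⟩ with ha
  set b : Fin n := ⟨k + 1, by omega⟩ with hb
  have haH : a ∈ Hᶜ := by simp [hH, ha]
  have hbH : b ∉ H := by simp [hH, hb]
  have hrow : k * (1 + t) ^ 2 + 4 * t ^ 2 ≤ ∑ w ∈ nbr (SnkPlus n k) a, (x a + x w) ^ 2 := by
    have h1 : insert b H ⊆ nbr (SnkPlus n k) a := by
      intro w hw
      rw [Finset.mem_insert] at hw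
      simp only [mem_nbr, SnkPlus, SimpleGraph.fromRel_adj]
      rcases hw with rfl | hw
      · simp [ha, hb]
      · have : (w : ℕ) < k := by simpa [hH] using hw
        refine ⟨?_, by tauto⟩
        rintro rfl
        exact Finset.mem_compl.1 haH hw
    refine le_trans (le_of_eq ?_) (Finset.sum_le_sum_of_subset_of_nonneg h1
      fun _ _ _ => sq_nonneg _)
    rw [Finset.sum_insert hbH, Finset.sum_congr rfl (g := fun _ => (1 + t) ^ 2) fun i hi => by
      simp [hx, hi, Finset.mem_compl.1 haH, add_comm]]
    simp only [hx, hbH, Finset.mem_compl.1 haH, if_false, Finset.sum_const, nsmul_eq_mul, hHc]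
    ring
  have hform : k * (4 * (k - 1) + (n - k) * (1 + t) ^ 2)
      + ((n - k) * (k * (1 + t) ^ 2) + 4 * t ^ 2) ≤ edgeForm (SnkPlus n k) x := by
    rw [edgeForm, hsplit]
    refine add_le_add (le_of_eq ?_) ?_
    · rw [Finset.sum_congr rfl hin, Finset.sum_const, nsmul_eq_mul, hHc]
    · rw [← Finset.add_sum_erase _ _ haH]
      have h1 := Finset.sum_le_sum fun v (hv : v ∈ Hᶜ.erase a) => hout v (Finset.mem_of_mem_erase hv)
      have h2 := Finset.add_sum_erase Hᶜ (fun _ => k * (1 + t) ^ 2) haH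
      simp only [Finset.sum_const, nsmul_eq_mul, hcc] at h1 h2
      linarith
  have := edgeForm_le (SnkPlus n k) x
  rw [hnorm] at this
  linarith

theorem lt_qIndex_SnkPlus_one {n : ℕ} (hn : 3 ≤ n) : (n : ℝ) < qIndex (SnkPlus n 1) := by
  have h := qIndex_SnkPlus_mul_ge (n := n) (k := 1) (by omega) (1 / ((n : ℝ) - 1))
  have hn' : (3 : ℝ) ≤ n := by exact_mod_cast hn
  have hm : (0 : ℝ) < n - 1 := by linarith
  have h1 : (1 + ((n : ℝ) - 1) * (1 / ((n : ℝ) - 1)) ^ 2) = n / (n - 1) := by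
    field_simp
    ring
  have h2 : ((n : ℝ) - 1) * (1 + 1 / ((n : ℝ) - 1)) ^ 2 = n * (n / (n - 1)) := by
    field_simp
    ring
  have h3 : (0 : ℝ) < 2 * (1 / ((n : ℝ) - 1)) ^ 2 := by positivity
  push_cast at h
  rw [h1, one_mul, h2] at h
  have h4 : (0 : ℝ) < n / (n - 1) := by positivity
  nlinarith

theorem qIndex_SnkPlus_ge {n k : ℕ} (hk : 2 ≤ k) (hn : 7 * k ^ 2 ≤ n) :
    (n : ℝ) + 2 * k - 2 - 2 / 7 ≤ qIndex (SnkPlus n k) := by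
  have hk' : (2 : ℝ) ≤ k := by exact_mod_cast hk
  have hn' : 7 * (k : ℝ) ^ 2 ≤ n := by exact_mod_cast hn
  set q : ℝ := n + 2 * k - 2 - 2 / 7 with hq
  have hqk : 0 < q - k := by nlinarith
  set t : ℝ := k / (q - k) with ht
  have htq : t * (q - k) = k := by rw [ht, div_mul_cancel₀ _ hqk.ne']
  have ht0 : 0 < t := by positivity
  have h := qIndex_SnkPlus_mul_ge (n := n) (k := k) (by nlinarith) t
  have hkn : (k : ℝ) < n := by nlinarith
  have hpos : (0 : ℝ) < k + (n - k) * t ^ 2 := by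
    have := mul_pos (sub_pos.2 hkn) (pow_pos ht0 2)
    linarith
  refine le_of_mul_le_mul_right (le_trans ?_ h) hpos
  have h1 : q * t ^ 2 = k * t * (1 + t) := by linear_combination t * htq
  have h2 : q ≤ 2 * (k - 1) + (n - k) * (1 + t) := by
    have h3 : (q - 2 * (k - 1) - (n - k)) * (q - k) ≤ (n - k) * (t * (q - k)) := by
      rw [htq, hq]
      nlinarith
    have h4 : q - 2 * (k - 1) - (n - k) ≤ (n - k) * t := by
      refine le_of_mul_le_mul_right ?_ hqk
      linarith
    linarith
  have h5 := mul_le_mul_of_nonneg_left h2 (by linarith : (0 : ℝ) ≤ k)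
  have h6 : q * (k + (n - k) * t ^ 2) = q * k + (n - k) * (k * t * (1 + t)) := by
    rw [← h1]
    ring
  rw [h6]
  nlinarith [sq_nonneg t]

theorem iso_of_edges_outside {k n : ℕ} (hk : 1 ≤ k) (hkn : k + 2 ≤ n) {G : SimpleGraph (Fin n)}
    {H : Finset (Fin n)} (hH : H.card = k)
    (hE : ∀ a ∉ H, ∀ b ∉ H, ∀ c ∉ H, ∀ d ∉ H, G.Adj a b → G.Adj c d →
      (c = a ∧ d = b) ∨ (c = b ∧ d = a))
    (hq : qIndex (SnkPlus n k) ≤ qIndex G) : Nonempty (G ≃g SnkPlus n k) := by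
  by_cases hR : ∃ a ∉ H, ∃ b ∉ H, G.Adj a b
  · obtain ⟨a, ha, b, hb, hab⟩ := hR
    refine iso_of_le_joinPlus hk hH ha hb hab.ne (fun i j hij => ⟨hij.ne, ?_⟩) hq
    by_contra! hc
    rcases hE a ha b hb i hc.1 j hc.2.1 hab hij with h | h
    · exact hc.2.2.1 h.1 h.2
    · exact hc.2.2.2 h.1 h.2
  · push Not at hR
    have hc : 1 < Hᶜ.card := by
      rw [Finset.card_compl, Fintype.card_fin]
      omega
    obtain ⟨a, ha, b, hb, hab⟩ := Finset.one_lt_card.1 hc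
    refine iso_of_le_joinPlus hk hH (Finset.mem_compl.1 ha) (Finset.mem_compl.1 hb) hab
      (fun i j hij => ⟨hij.ne, ?_⟩) hq
    by_contra! hc
    exact hR i hc.1 j hc.2.1 hij

theorem hasPathOn_five {V : Type*} {G : SimpleGraph V} {a b c d e : V} (hab : G.Adj a b)
    (hbc : G.Adj b c) (hcd : G.Adj c d) (hde : G.Adj d e) (hac : a ≠ c) (had : a ≠ d)
    (hae : a ≠ e) (hbd : b ≠ d) (hbe : b ≠ e) (hce : c ≠ e) : HasPathOn G 5 :=
  IsPathList.hasPathOn (l := [a, b, c, d, e])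
    ⟨by simp [hab, hbc, hcd, hde],
      by simp [hab.ne, hbc.ne, hcd.ne, hde.ne, hac, had, hae, hbd, hbe, hce]⟩ (by simp) (by simp)

/-- Some edge `uv` satisfies `q(G) ≤ d(u) + d(v)`. -/
theorem exists_adj_qIndex_le {V : Type*} [Fintype V] [DecidableEq V] [Nonempty V]
    {G : SimpleGraph V} (hq : 0 < qIndex G) :
    ∃ u v, G.Adj u v ∧ qIndex G ≤ (nbr G u).card + (nbr G v).card := by
  obtain ⟨x, u, hx⟩ := exists_isPerron G
  have hu := hx.eigen u
  rw [hx.eq_one, mul_one, mul_one] at hu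
  have hne : (nbr G u).Nonempty := by
    rw [Finset.nonempty_iff_ne_empty]
    intro h0
    rw [h0] at hu
    simp at hu
    linarith
  obtain ⟨v, hv, hmax⟩ := Finset.exists_max_image (nbr G u) x hne
  refine ⟨u, v, mem_nbr.1 hv, ?_⟩
  have h1 : ∑ w ∈ nbr G u, x w ≤ (nbr G u).card * x v := by
    simpa using Finset.sum_le_card_nsmul _ _ _ hmax
  have h2 : ∑ w ∈ nbr G v, x w ≤ (nbr G v).card := by
    simpa using Finset.sum_le_card_nsmul (nbr G v) x 1 fun w _ => hx.le_one w
  have h3 := hx.eigen v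
  have h4 := hx.nonneg v
  by_contra! hc
  nlinarith

theorem iso_of_not_hasPathOn_one {n : ℕ} (hn : 7 ≤ n) {G : SimpleGraph (Fin n)}
    (hG : ¬ HasPathOn G 5) (hq : qIndex (SnkPlus n 1) ≤ qIndex G) :
    Nonempty (G ≃g SnkPlus n 1) := by
  have : Nonempty (Fin n) := ⟨⟨0, by omega⟩⟩
  have hqn := (lt_qIndex_SnkPlus_one (n := n) (by omega)).trans_le hq
  have hbig : ∀ v, (nbr G v).card ≤ n - 1 := by
    intro v
    have h : nbr G v ⊆ Finset.univ.erase v := fun w hw => by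
      simpa using (mem_nbr.1 hw).ne'
    simpa using Finset.card_le_card h
  have hpick : ∀ s t : Finset (Fin n), t.card < s.card → ∃ v ∈ s, v ∉ t := fun s t h =>
    Finset.exists_mem_notMem_of_card_lt_card h
  have hdom : ∃ u, n - 1 ≤ (nbr G u).card := by
    obtain ⟨u, v, huv, hle⟩ := exists_adj_qIndex_le (G := G) (by
      have : (0 : ℝ) ≤ n := by positivity
      linarith)
    have hsum : n + 1 ≤ (nbr G u).card + (nbr G v).card := by
      have : (n : ℝ) < ((nbr G u).card + (nbr G v).card : ℕ) := by
        push_cast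
        linarith
      exact_mod_cast this
    obtain ⟨c, hc⟩ : (nbr G u ∩ nbr G v).Nonempty := by
      rw [← Finset.card_pos]
      have h1 := Finset.card_union_add_card_inter (nbr G u) (nbr G v)
      have h2 := Finset.card_le_univ (nbr G u ∪ nbr G v)
      rw [Fintype.card_fin] at h2
      omega
    have key : ∀ u v c, G.Adj u v → G.Adj u c → G.Adj v c →
        n + 1 ≤ (nbr G u).card + (nbr G v).card → 4 ≤ (nbr G u).card → n - 1 ≤ (nbr G u).card := by
      intro u v c huv huc hvc hsum hu
      by_contra! hlt
      obtain ⟨b, hb, hb'⟩ := hpick (nbr G v) {u, c} (Finset.card_le_two.trans_lt (by omega))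
      obtain ⟨a, ha, ha'⟩ := hpick (nbr G u) {v, c, b} (Finset.card_le_three.trans_lt (by omega))
      simp only [Finset.mem_insert, Finset.mem_singleton, not_or, mem_nbr] at hb hb' ha ha'
      exact hG (hasPathOn_five ha.symm huc hvc.symm hb ha'.2.1 ha'.1 ha'.2.2 huv.ne
        (Ne.symm hb'.1) (Ne.symm hb'.2))
    rw [Finset.mem_inter, mem_nbr, mem_nbr] at hc
    by_cases h4 : 4 ≤ (nbr G u).card
    · exact ⟨u, key u v c huv hc.1 hc.2 hsum h4⟩
    · exact ⟨v, key v u c huv.symm hc.2 hc.1 (by omega) (by omega)⟩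
  obtain ⟨u, hu⟩ := hdom
  have huall : ∀ w, w ≠ u → G.Adj u w := by
    intro w hw
    by_contra hc
    have h : nbr G u ⊆ (Finset.univ.erase u).erase w := fun z hz => by
      rw [mem_nbr] at hz
      simp only [Finset.mem_erase, Finset.mem_univ, and_true]
      exact ⟨fun h => hc (h ▸ hz), hz.ne'⟩
    have h2 := Finset.card_le_card h
    rw [Finset.card_erase_of_mem (by simpa using hw), Finset.card_erase_of_mem (by simp)] at h2
    simp at h2
    omega
  have hP3 : ∀ a b c, a ≠ u → b ≠ u → c ≠ u → G.Adj a b → G.Adj b c → a = c := by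
    intro a b c ha hb hc hab hbc
    by_contra hac
    obtain ⟨d, _, hd⟩ := hpick Finset.univ {u, a, b, c} (by
      refine Finset.card_le_four.trans_lt ?_
      simp
      omega)
    simp only [Finset.mem_insert, Finset.mem_singleton, not_or] at hd
    exact hG (hasPathOn_five hbc.symm hab.symm (huall a ha).symm (huall d hd.1) (Ne.symm hac) hc
      (Ne.symm hd.2.2.2) hb (Ne.symm hd.2.2.1) (Ne.symm hd.2.1))
  refine iso_of_edges_outside le_rfl (by omega) (Finset.card_singleton u) ?_ hq
  intro a ha b hb c hc d hd hab hcd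
  simp only [Finset.mem_singleton] at ha hb hc hd
  by_cases h1 : c = a
  · subst h1
    exact Or.inl ⟨rfl, hP3 d c b hd hc hb hcd.symm hab⟩
  by_cases h2 : c = b
  · subst h2
    exact Or.inr ⟨rfl, hP3 d c a hd hc ha hcd.symm hab.symm⟩
  by_cases h3 : d = a
  · subst h3
    exact absurd (hP3 c d b hc hd hb hcd hab) h2
  by_cases h4 : d = b
  · subst h4
    exact absurd (hP3 c d a hc hd ha hcd hab.symm) h1
  exact absurd (hasPathOn_five hab.symm (huall a ha).symm (huall c hc) hcd hb (Ne.symm h2)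
    (Ne.symm h4) (Ne.symm h1) (Ne.symm h3) (Ne.symm hd)) hG

/-- All vertices of `H` have more than half of the other vertices as neighbours, with a surplus
measured by `k`. -/
def HighDegree {V : Type*} [Fintype V] (G : SimpleGraph V) (k : ℕ) (H : Finset V) : Prop :=
  ∀ w ∈ H, Fintype.card V + 2 * k + 2 ≤ 2 * (nbr G w).card

theorem HighDegree.exists_adj {V : Type*} [Fintype V] [DecidableEq V] {G : SimpleGraph V}
    {k : ℕ} {H : Finset V} (hH : HighDegree G k H) {w : V} (hw : w ∈ H) {p : List V}
    (hp : p.length ≤ 2 * k + 2) : ∃ r, G.Adj w r ∧ r ∉ p := by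
  have h1 := hH w hw
  have h2 : (nbr G w).card + 1 ≤ Fintype.card V := by
    have h : nbr G w ⊆ Finset.univ.erase w := fun z hz => by
      simpa using (mem_nbr.1 hz).ne'
    have h3 := Finset.card_le_card h
    rw [Finset.card_erase_of_mem (Finset.mem_univ w), Finset.card_univ] at h3
    have := Fintype.card_pos_iff.2 ⟨w⟩
    omega
  have h3 := p.toFinset_card_le
  obtain ⟨r, hr, hr'⟩ := Finset.exists_mem_notMem_of_card_lt_card
    (show p.toFinset.card < (nbr G w).card by omega)
  exact ⟨r, mem_nbr.1 hr, by simpa using hr'⟩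

/-- Vertices of large degree can be linked, in any prescribed order, by a path that uses one
further vertex between any two consecutive ones. -/
theorem HighDegree.exists_chain {V : Type*} [Fintype V] [DecidableEq V] {G : SimpleGraph V}
    {k : ℕ} {H : Finset V} (hH : HighDegree G k H) (l : List V) :
    ∀ F : Finset V, l ≠ [] → l.Nodup → (∀ v ∈ l, v ∈ H) → (∀ v ∈ l, v ∉ F) →
      F.card + 2 * l.length ≤ 2 * k + 5 →
      ∃ p : List V, IsPathList G p ∧ p.head? = l.head? ∧ p.getLast? = l.getLast? ∧
        p.length + 1 = 2 * l.length ∧ ∀ v ∈ p, v ∉ F := by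
  induction l with
  | nil => exact fun _ h => absurd rfl h
  | cons h l ih =>
    intro F _ hnd hlH hlF hc
    rcases l with _ | ⟨h', l⟩
    · exact ⟨[h], ⟨List.isChain_singleton h, List.nodup_singleton h⟩, rfl, rfl, rfl, hlF⟩
    simp only [List.length_cons] at hc
    have hcom : (F ∪ l.toFinset).card < (nbr G h ∩ nbr G h').card := by
      have h1 := hH h (hlH h (by simp))
      have h2 := hH h' (hlH h' (by simp))
      have h3 := Finset.card_union_add_card_inter (nbr G h) (nbr G h')
      have h4 := Finset.card_le_univ (nbr G h ∪ nbr G h')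
      have h5 := Finset.card_union_le F l.toFinset
      have h6 := l.toFinset_card_le
      omega
    obtain ⟨r, hr, hrF⟩ := Finset.exists_mem_notMem_of_card_lt_card hcom
    simp only [Finset.mem_inter, mem_nbr, Finset.mem_union, List.mem_toFinset, not_or] at hr hrF
    rw [List.nodup_cons] at hnd
    obtain ⟨p, hp, hhead, hlast, hlen, hpF⟩ := ih (insert h (insert r F)) (by simp) hnd.2
      (fun v hv => hlH v (List.mem_cons_of_mem _ hv)) (by
        intro v hv
        simp only [Finset.mem_insert, not_or]
        refine ⟨fun h0 => hnd.1 (h0 ▸ hv), fun h0 => ?_, hlF v (List.mem_cons_of_mem _ hv)⟩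
        rcases List.mem_cons.1 hv with h1 | h1
        · exact hr.2.ne (h1 ▸ h0)
        · exact hrF.2 (h0 ▸ h1)) (by
        have h1 := Finset.card_insert_le h (insert r F)
        have h2 := Finset.card_insert_le r F
        simp only [List.length_cons]
        omega)
    have hpF' : h ∉ p ∧ r ∉ p := by
      constructor <;> intro h0 <;> exact absurd (hpF _ h0) (by simp)
    refine ⟨h :: r :: p, ⟨?_, ?_⟩, rfl, ?_, ?_, ?_⟩
    · rw [List.isChain_cons_cons]
      refine ⟨hr.1, ?_⟩
      rw [List.isChain_cons]
      refine ⟨fun y hy => ?_, hp.1⟩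
      rw [hhead] at hy
      simp only [List.head?_cons, Option.mem_def, Option.some.injEq] at hy
      exact hy ▸ hr.2.symm
    · simp [hp.2, hpF', hr.1.ne]
    · rcases p with _ | ⟨z, p⟩
      · simp at hhead
      · simpa [List.getLast?_cons_cons] using hlast
    · simp only [List.length_cons] at hlen ⊢
      omega
    · intro v hv
      rcases List.mem_cons.1 hv with rfl | hv
      · exact hlF _ (by simp)
      rcases List.mem_cons.1 hv with rfl | hv
      · exact hrF.1
      · have := hpF v hv
        simp only [Finset.mem_insert, not_or] at this
        exact this.2.2

theorem HighDegree.exists_append {V : Type*} [Fintype V] [DecidableEq V] {G : SimpleGraph V}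
    {k : ℕ} {H : Finset V} (hH : HighDegree G k H) {p : List V} (hp : IsPathList G p) {w : V}
    (hw : w ∈ H) (hlast : p.getLast? = some w) (hlen : p.length ≤ 2 * k + 2) :
    HasPathOn G (p.length + 1) := by
  obtain ⟨r, hr, hrp⟩ := hH.exists_adj hw hlen
  refine IsPathList.hasPathOn (l := p ++ [r]) ⟨hp.1.append (List.isChain_singleton r) ?_, ?_⟩
    (by simp) (by simp)
  · intro x hx y hy
    rw [hlast] at hx
    simp at hx hy
    rw [← hx, ← hy]
    exact hr
  · rw [List.nodup_append]
    refine ⟨hp.2, List.nodup_singleton r, ?_⟩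
    intro x hx y hy
    simp at hy
    rintro rfl
    exact hrp (hy ▸ hx)

theorem IsPathList.cons {V : Type*} {G : SimpleGraph V} {p : List V} (hp : IsPathList G p)
    {v w : V} (hhead : p.head? = some w) (hv : v ∉ p) (hvw : G.Adj v w) : IsPathList G (v :: p) := by
  refine ⟨List.isChain_cons.2 ⟨fun y hy => ?_, hp.1⟩, List.nodup_cons.2 ⟨hv, hp.2⟩⟩
  rw [hhead] at hy
  simp at hy
  exact hy ▸ hvw

theorem HighDegree.card_le {V : Type*} [Fintype V] [DecidableEq V] {G : SimpleGraph V}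
    {k : ℕ} {H : Finset V} (hH : HighDegree G k H) (hG : ¬ HasPathOn G (2 * k + 3)) :
    H.card ≤ k := by
  by_contra! hc
  obtain ⟨K, hK, hKc⟩ := Finset.exists_subset_card_eq (show k + 1 ≤ H.card by omega)
  have hlen : K.toList.length = k + 1 := by simp [hKc]
  have hne : K.toList ≠ [] := by
    intro h0
    rw [h0] at hlen
    simp at hlen
  have hKH : ∀ v ∈ K.toList, v ∈ H := fun v hv => hK (by simpa using hv)
  obtain ⟨p, hp, hhead, hlast, hplen, -⟩ := hH.exists_chain K.toList ∅ hne (Finset.nodup_toList K)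
    hKH (by simp) (by simp [hKc]; omega)
  rw [List.head?_eq_some_head hne] at hhead
  rw [List.getLast?_eq_some_getLast hne] at hlast
  obtain ⟨r, hr, hrp⟩ := hH.exists_adj (hKH _ (List.head_mem hne)) (p := p) (by omega)
  have h1 := hp.cons hhead hrp hr.symm
  have h2 := hH.exists_append h1 (hKH _ (List.getLast_mem hne)) (by
    rcases p with _ | ⟨z, p⟩
    · simp at hhead
    · simpa [List.getLast?_cons_cons] using hlast) (by simp; omega)
  rw [List.length_cons, show p.length + 1 + 1 = 2 * k + 3 by omega] at h2
  exact hG h2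

/-- There is no path on three vertices outside `H` with an end adjacent to `H`. -/
theorem HighDegree.not_adj_adj {V : Type*} [Fintype V] [DecidableEq V] {G : SimpleGraph V}
    {k : ℕ} {H : Finset V} (hH : HighDegree G k H) (hG : ¬ HasPathOn G (2 * k + 3))
    (hHc : H.card = k) {u a b c : V} (hu : u ∈ H) (ha : a ∉ H) (hb : b ∉ H) (hc : c ∉ H)
    (hua : G.Adj u a) (hab : G.Adj a b) (hac : a ≠ c) : ¬ G.Adj b c := by
  intro hbc
  have hpos := Finset.card_pos.2 ⟨u, hu⟩
  set l : List V := u :: (H.erase u).toList with hl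
  have hlen : l.length = k := by
    simp [hl, Finset.card_erase_of_mem hu]
    omega
  have hlH : ∀ v ∈ l, v ∈ H := by
    intro v hv
    simp [hl] at hv
    rcases hv with rfl | hv
    · exact hu
    · exact hv.2
  obtain ⟨p, hp, hhead, hlast, hplen, hpF⟩ := hH.exists_chain l {a, b, c} (by simp [hl])
    (by simp [hl, Finset.nodup_toList]) hlH (by
      intro v hv
      have := hlH v hv
      simp only [Finset.mem_insert, Finset.mem_singleton]
      rintro (rfl | rfl | rfl) <;> contradiction) (by
      have := Finset.card_le_three (a := a) (b := b) (c := c)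
      omega)
  simp only [Finset.mem_insert, Finset.mem_singleton] at hpF
  have hne : l ≠ [] := by simp [hl]
  have hlast' := hlH _ (List.getLast_mem hne)
  rw [List.getLast?_eq_some_getLast hne] at hlast
  have h1 : IsPathList G (a :: p) := hp.cons (w := u) (by rw [hhead]; rfl)
    (fun h => hpF a h (by simp)) hua.symm
  have h2 : IsPathList G (b :: a :: p) := h1.cons (w := a) rfl (by
    rw [List.mem_cons, not_or]
    exact ⟨hab.ne', fun h => hpF b h (by simp)⟩) hab.symm
  have h3 : IsPathList G (c :: b :: a :: p) := h2.cons (w := b) rfl (by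
    simp only [List.mem_cons, not_or]
    exact ⟨hbc.ne', hac.symm, fun h => hpF c h (by simp)⟩) hbc.symm
  have h4 := hH.exists_append h3 hlast' (by
    rcases p with _ | ⟨z, p⟩
    · simp [hl] at hhead
    · simpa [List.getLast?_cons_cons] using hlast) (by simp; omega)
  simp only [List.length_cons] at h4
  rw [show p.length + 1 + 1 + 1 + 1 = 2 * k + 3 by omega] at h4
  exact hG h4

/-- Two disjoint edges outside `H` cannot be attached to different vertices of `H`. -/
theorem HighDegree.not_adj_of_disjoint {V : Type*} [Fintype V] [DecidableEq V]
    {G : SimpleGraph V} {k : ℕ} {H : Finset V} (hH : HighDegree G k H)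
    (hG : ¬ HasPathOn G (2 * k + 3)) (hHc : H.card = k) {u w a b c d : V} (hu : u ∈ H)
    (hw : w ∈ H) (huw : u ≠ w) (ha : a ∉ H) (hb : b ∉ H) (hc : c ∉ H) (hd : d ∉ H)
    (hua : G.Adj u a) (hab : G.Adj a b) (hcd : G.Adj c d) (hac : a ≠ c) (had : a ≠ d)
    (hbc : b ≠ c) (hbd : b ≠ d) : ¬ G.Adj w c := by
  intro hwc
  have hwu : w ∈ H.erase u := Finset.mem_erase.2 ⟨huw.symm, hw⟩
  have hpos := Finset.card_pos.2 ⟨w, hwu⟩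
  have hcu := Finset.card_erase_of_mem hu
  set l : List V := u :: (((H.erase u).erase w).toList ++ [w]) with hl
  have hlen : l.length = k := by
    simp [hl, Finset.card_erase_of_mem hwu]
    omega
  have hlH : ∀ v ∈ l, v ∈ H := by
    intro v hv
    simp [hl] at hv
    rcases hv with rfl | hv | rfl
    · exact hu
    · exact hv.2.2
    · exact hw
  obtain ⟨p, hp, hhead, hlast, hplen, hpF⟩ := hH.exists_chain l {a, b, c, d} (by simp [hl])
    (by
      simp only [hl, List.nodup_cons, List.nodup_append, Finset.nodup_toList, List.mem_append,
        Finset.mem_toList, Finset.mem_erase, List.mem_singleton]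
      refine ⟨by tauto, trivial, by simp, ?_⟩
      rintro x hx y rfl
      exact hx.1) hlH (by
      intro v hv
      have := hlH v hv
      simp only [Finset.mem_insert, Finset.mem_singleton]
      rintro (rfl | rfl | rfl | rfl) <;> contradiction) (by
      have := Finset.card_le_four (a := a) (b := b) (c := c) (d := d)
      omega)
  simp only [Finset.mem_insert, Finset.mem_singleton] at hpF
  have h1 : IsPathList G (a :: p) := hp.cons (w := u) (by rw [hhead]; rfl)
    (fun h => hpF a h (by simp)) hua.symm
  have h2 : IsPathList G (b :: a :: p) := h1.cons (w := a) rfl (by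
    rw [List.mem_cons, not_or]
    exact ⟨hab.ne', fun h => hpF b h (by simp)⟩) hab.symm
  have hlast' : (b :: a :: p).getLast? = some w := by
    rcases p with _ | ⟨z, p⟩
    · simp [hl] at hhead
    · rw [List.getLast?_cons_cons, List.getLast?_cons_cons, hlast]
      simp [hl, List.getLast?_cons]
  refine hG (IsPathList.hasPathOn (l := (b :: a :: p) ++ [c, d]) ⟨h2.1.append ?_ ?_, ?_⟩
    (by simp; omega) (by omega))
  · simpa using hcd
  · intro x hx y hy
    rw [hlast'] at hx
    simp at hx hy
    rw [← hx, ← hy]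
    exact hwc
  · rw [List.nodup_append]
    refine ⟨h2.2, by simpa using hcd.ne, ?_⟩
    have h5 : c ∉ p := fun h => hpF c h (by simp)
    have h6 : d ∉ p := fun h => hpF d h (by simp)
    rintro x hx y hy rfl
    simp only [List.mem_cons, List.not_mem_nil, or_false] at hx hy
    rcases hy with rfl | rfl
    · rcases hx with h | h | h
      · exact hbc h.symm
      · exact hac h.symm
      · exact h5 h
    · rcases hx with h | h | h
      · exact hbd h.symm
      · exact had h.symm
      · exact h6 h

theorem IsPerron.mul_le {V : Type*} [Fintype V] [DecidableEq V] {G : SimpleGraph V} {x : V → ℝ}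
    {u : V} (hx : IsPerron G x u) (v : V) :
    (qIndex G + 1 - (nbr G v).card) * x v ≤ ∑ w, x w := by
  have h1 : nbr G v ⊆ Finset.univ.erase v := fun z hz => by
    simpa using (mem_nbr.1 hz).ne'
  have h2 := Finset.sum_le_sum_of_subset_of_nonneg h1 (f := x) fun i _ _ => hx.nonneg i
  have h3 := Finset.add_sum_erase Finset.univ x (Finset.mem_univ v)
  have h4 := hx.eigen v
  linarith

theorem IsPerron.qIndex_add_one_le {V : Type*} [Fintype V] [DecidableEq V] {G : SimpleGraph V}
    {x : V → ℝ} {u : V} (hx : IsPerron G x u) :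
    qIndex G + 1 ≤ (nbr G u).card + ∑ w, x w := by
  have h := hx.mul_le u
  rw [hx.eq_one] at h
  linarith

theorem IsPerron.sum_le {V : Type*} [Fintype V] [DecidableEq V] {G : SimpleGraph V} {x : V → ℝ}
    {u : V} {k : ℕ} (hx : IsPerron G x u) (hG : ¬ HasPathOn G (2 * k + 3))
    (hq : (Fintype.card V : ℝ) ≤ qIndex G) : ∑ w, x w ≤ 4 * k + 2 := by
  have hEG : ((∑ v, (nbr G v).card : ℕ) : ℝ) ≤ ((2 * k + 1) * Fintype.card V : ℕ) := by
    have := sum_card_nbr_le hG Finset.univ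
    simp only [Finset.inter_univ, Finset.card_univ] at this
    exact_mod_cast this
  push_cast at hEG
  have h1 : ∀ v, qIndex G * x v ≤ 2 * (nbr G v).card := by
    intro v
    have h2 : ∑ w ∈ nbr G v, x w ≤ (nbr G v).card := by
      simpa using Finset.sum_le_card_nsmul (nbr G v) x 1 fun w _ => hx.le_one w
    have h3 : ((nbr G v).card : ℝ) * x v ≤ (nbr G v).card :=
      mul_le_of_le_one_right (by positivity) (hx.le_one v)
    rw [hx.eigen v]
    linarith
  have h2 := Finset.sum_le_sum fun v (_ : v ∈ Finset.univ) => h1 v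
  rw [← Finset.mul_sum, ← Finset.mul_sum] at h2
  have h3 : (0 : ℝ) < Fintype.card V := by
    exact_mod_cast Fintype.card_pos_iff.2 ⟨u⟩
  have h4 : 0 ≤ ∑ w, x w := Finset.sum_nonneg fun w _ => hx.nonneg w
  have h5 := mul_le_mul_of_nonneg_right hq h4
  refine le_of_mul_le_mul_left ?_ h3
  linarith

theorem card_nbr_eq_add {V : Type*} [Fintype V] [DecidableEq V] (G : SimpleGraph V)
    (H : Finset V) (v : V) :
    ((nbr G v).card : ℝ) = (nbr G v ∩ H).card + (nbr G v ∩ Hᶜ).card := by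
  rw [← Finset.sdiff_eq_inter_compl]
  exact_mod_cast (Finset.card_inter_add_card_sdiff _ _).symm

/-- The eigenvalue equation summed over the complement of `H`. -/
theorem IsPerron.mul_sum_le {V : Type*} [Fintype V] [DecidableEq V] {G : SimpleGraph V}
    {x : V → ℝ} {u : V} (hx : IsPerron G x u) (H : Finset V) {y : ℝ}
    (hy : ∀ v ∉ H, x v ≤ y) :
    qIndex G * ∑ v, x v ≤ (∑ v ∈ H, x v) * (qIndex G + Fintype.card V)
      + H.card * (∑ v, x v - 2 * ∑ v ∈ H, x v)
      + 2 * y * ∑ v ∈ Hᶜ, ((nbr G v ∩ Hᶜ).card : ℝ) := by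
  have hS := Finset.sum_add_sum_compl H x
  have hcc : ((Hᶜ.card : ℕ) : ℝ) = Fintype.card V - H.card := by
    rw [Finset.card_compl, Nat.cast_sub (Finset.card_le_univ H)]
  have h1 : qIndex G * ∑ v ∈ Hᶜ, x v
      = ∑ v ∈ Hᶜ, ((nbr G v).card * x v + ∑ w ∈ nbr G v, x w) := by
    rw [Finset.mul_sum]
    exact Finset.sum_congr rfl fun v _ => hx.eigen v
  have h2 : ∑ v ∈ Hᶜ, ((nbr G v).card : ℝ) * x v
      ≤ H.card * ∑ v ∈ Hᶜ, x v + y * ∑ v ∈ Hᶜ, ((nbr G v ∩ Hᶜ).card : ℝ) := by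
    rw [Finset.mul_sum, Finset.mul_sum, ← Finset.sum_add_distrib]
    refine Finset.sum_le_sum fun v hv => ?_
    have h3 : ((nbr G v ∩ H).card : ℝ) ≤ H.card := by
      exact_mod_cast Finset.card_le_card Finset.inter_subset_right
    have h4 := mul_le_mul_of_nonneg_right h3 (hx.nonneg v)
    have h5 := mul_le_mul_of_nonneg_left (hy v (Finset.mem_compl.1 hv))
      (show (0 : ℝ) ≤ (nbr G v ∩ Hᶜ).card by positivity)
    rw [card_nbr_eq_add G H]
    linarith
  have h3 : ∑ v ∈ Hᶜ, ∑ w ∈ nbr G v, x w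
      ≤ (Fintype.card V - H.card) * ∑ v ∈ H, x v + y * ∑ v ∈ Hᶜ, ((nbr G v ∩ Hᶜ).card : ℝ) := by
    have h4 : ∀ v ∈ Hᶜ, ∑ w ∈ nbr G v, x w
        = ∑ w ∈ nbr G v ∩ H, x w + ∑ w ∈ nbr G v ∩ Hᶜ, x w := by
      intro v _
      rw [← Finset.sdiff_eq_inter_compl]
      exact (Finset.sum_inter_add_sum_sdiff _ _ _).symm
    rw [Finset.sum_congr rfl h4, Finset.sum_add_distrib]
    refine add_le_add ?_ ?_
    · rw [sum_nbr_comm G Hᶜ H fun _ w => x w, Finset.mul_sum]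
      refine Finset.sum_le_sum fun w _ => ?_
      have h5 : ((nbr G w ∩ Hᶜ).card : ℝ) ≤ Hᶜ.card := by
        exact_mod_cast Finset.card_le_card Finset.inter_subset_right
      rw [Finset.sum_const, nsmul_eq_mul, ← hcc]
      exact mul_le_mul_of_nonneg_right h5 (hx.nonneg w)
    · rw [Finset.mul_sum]
      refine Finset.sum_le_sum fun v _ => ?_
      have := Finset.sum_le_card_nsmul (nbr G v ∩ Hᶜ) x y fun w hw =>
        hy w (Finset.mem_compl.1 (Finset.mem_inter.1 hw).2)
      rw [nsmul_eq_mul] at this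
      linarith
  rw [Finset.sum_add_distrib] at h1
  rw [← hS]
  linarith

theorem sum_card_nbr_compl_le {V : Type*} [Fintype V] [DecidableEq V] {G : SimpleGraph V} {k : ℕ}
    (hG : ¬ HasPathOn G (2 * k + 3)) (H : Finset V) :
    ∑ v ∈ Hᶜ, ((nbr G v ∩ Hᶜ).card : ℝ) ≤ (2 * k + 1) * Fintype.card V
      - 2 * ∑ v ∈ H, ((nbr G v).card : ℝ) + H.card * (H.card - 1) := by
  have hEG : ((∑ v, (nbr G v).card : ℕ) : ℝ) ≤ ((2 * k + 1) * Fintype.card V : ℕ) := by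
    have := sum_card_nbr_le hG Finset.univ
    simp only [Finset.inter_univ, Finset.card_univ] at this
    exact_mod_cast this
  push_cast at hEG
  rw [← Finset.sum_add_sum_compl H,
    Finset.sum_congr (s₁ := Hᶜ) rfl fun v _ => card_nbr_eq_add G H v,
    Finset.sum_add_distrib] at hEG
  have h1 : ∑ v ∈ Hᶜ, ((nbr G v ∩ H).card : ℝ) = ∑ v ∈ H, ((nbr G v ∩ Hᶜ).card : ℝ) := by
    simpa using sum_nbr_comm G Hᶜ H fun _ _ => 1
  have h2 : ∑ v ∈ H, ((nbr G v).card : ℝ) - H.card * (H.card - 1)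
      ≤ ∑ v ∈ H, ((nbr G v ∩ Hᶜ).card : ℝ) := by
    have h3 : ∑ v ∈ H, ((nbr G v ∩ H).card : ℝ) ≤ H.card * (H.card - 1) := by
      have h4 : ∀ v ∈ H, ((nbr G v ∩ H).card : ℝ) ≤ H.card - 1 := by
        intro v hv
        have h5 : nbr G v ∩ H ⊆ H.erase v := fun w hw => by
          rw [Finset.mem_inter, mem_nbr] at hw
          exact Finset.mem_erase.2 ⟨hw.1.ne', hw.2⟩
        have h6 := Finset.card_le_card h5
        have h7 := Finset.card_erase_add_one hv
        have h8 : (nbr G v ∩ H).card + 1 ≤ H.card := by omega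
        have h9 : ((nbr G v ∩ H).card : ℝ) + 1 ≤ H.card := by exact_mod_cast h8
        linarith
      simpa [nsmul_eq_mul] using Finset.sum_le_card_nsmul _ _ _ h4
    rw [Finset.sum_congr (s₁ := H) rfl fun v _ => card_nbr_eq_add G H v,
      Finset.sum_add_distrib]
    linarith
  linarith

/-- A linear lower bound for the degrees in terms of the eigenvector entries. -/
theorem IsPerron.mul_le_card_nbr {V : Type*} [Fintype V] [DecidableEq V] {G : SimpleGraph V}
    {x : V → ℝ} {u : V} (hx : IsPerron G x u) (hS : 3 * ∑ v, x v ≤ qIndex G + 1) {w : V}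
    (hw : qIndex G + 1 - ∑ v, x v ≤ 2 * (nbr G w).card) :
    x w * (qIndex G + 1 - ∑ v, x v) ≤ (nbr G w).card := by
  have h0 : 0 ≤ ∑ w, x w := Finset.sum_nonneg fun w _ => hx.nonneg w
  have h1 := hx.mul_le w
  have h2 := hx.nonneg w
  have h3 := hx.le_one w
  rcases le_total (x w) (1 / 2) with h | h
  · have := mul_le_mul_of_nonneg_right h
      (show 0 ≤ qIndex G + 1 - ∑ v, x v by linarith)
    linarith
  · refine le_of_mul_le_mul_left ?_ (show 0 < x w by linarith)
    nlinarith [mul_nonneg (sub_nonneg.2 h3) (mul_nonneg h2 (sub_nonneg.2 hS)),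
      mul_nonneg (sub_nonneg.2 h3) (mul_nonneg h0 (sub_nonneg.2 h))]

/-- A function that is affine in `t` on `[0, m]` and, for `t = m`, concave in `S` on `[a, b]` is
positive if it is positive at the relevant end points. -/
theorem pos_of_endpoints {m A B C D a b S t : ℝ} (hm : 0 < m) (ht0 : 0 ≤ t) (htm : t ≤ m)
    (hD : 0 ≤ D) (haS : a ≤ S) (hSb : S ≤ b) (hab : a < b) (h0 : 0 < A * S)
    (ha : 0 < A * a + m * (B + C * a - D * a ^ 2))
    (hb : 0 < A * b + m * (B + C * b - D * b ^ 2)) :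
    0 < A * S + t * (B + C * S - D * S ^ 2) := by
  have h1 : 0 < A * S + m * (B + C * S - D * S ^ 2) := by
    refine pos_of_mul_pos_right (a := b - a) ?_ (by linarith)
    have h2 : (b - a) * (A * S + m * (B + C * S - D * S ^ 2))
        = (b - S) * (A * a + m * (B + C * a - D * a ^ 2))
          + (S - a) * (A * b + m * (B + C * b - D * b ^ 2))
          + m * D * ((S - a) * (b - S) * (b - a)) := by ring
    have h3 := mul_nonneg (sub_nonneg.2 haS) (sub_nonneg.2 hSb)
    have h4 := mul_nonneg (mul_nonneg hm.le hD) (mul_nonneg h3 (by linarith : 0 ≤ b - a))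
    rw [h2]
    rcases haS.eq_or_lt with h | h
    · have h5 := mul_pos (show 0 < b - S by linarith) ha
      have h6 := mul_nonneg (sub_nonneg.2 haS) hb.le
      linarith
    · have h5 := mul_pos (sub_pos.2 h) hb
      have h6 := mul_nonneg (sub_nonneg.2 hSb) ha.le
      linarith
  refine pos_of_mul_pos_right (a := m) ?_ hm.le
  have h2 : m * (A * S + t * (B + C * S - D * S ^ 2))
      = (m - t) * (A * S) + t * (A * S + m * (B + C * S - D * S ^ 2)) := by ring
  rw [h2]
  rcases htm.eq_or_lt with h | h
  · have h3 := mul_pos (show 0 < t by linarith) h1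
    have h4 := mul_nonneg (sub_nonneg.2 htm) h0.le
    linarith
  · have h3 := mul_pos (sub_pos.2 h) h0
    have h4 := mul_nonneg ht0 h1.le
    linarith

theorem mass_bound_aux {n k m q S t a : ℝ} (hm : 0 < m) (ht0 : 0 ≤ t) (htm : t ≤ m)
    (hn : 0 < n) (haS : a ≤ S) (hma : m ≤ a) (hSb : S ≤ 4 * k + 2) (hab : a < 4 * k + 2)
    (hq : n + 2 * k - 16 / 7 ≤ q)
    (h0 : 0 < (n + 2 * k - 16 / 7 - m) * n - 4 * ((2 * k + 1) * n + m * (m - 1)))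
    (ha : 0 < ((n + 2 * k - 16 / 7 - m) * n - 4 * ((2 * k + 1) * n + m * (m - 1))) * a
      + m * (-(2 * n + 2 * k - 16 / 7 - 2 * m) * n + 8 * (n + 2 * k - 9 / 7) * a - 8 * a ^ 2))
    (hb : 0 < ((n + 2 * k - 16 / 7 - m) * n - 4 * ((2 * k + 1) * n + m * (m - 1)))
        * (4 * k + 2)
      + m * (-(2 * n + 2 * k - 16 / 7 - 2 * m) * n + 8 * (n + 2 * k - 9 / 7) * (4 * k + 2)
        - 8 * (4 * k + 2) ^ 2)) :
    t * (q + n - 2 * m) * n + 4 * S * ((2 * k + 1) * n - 2 * t * (q + 1 - S) + m * (m - 1))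
      < (q - m) * S * n := by
  have hS : 0 < S := by linarith
  have h1 := pos_of_endpoints (D := 8) hm ht0 htm (by norm_num) haS hSb hab (mul_pos h0 hS) ha hb
  have h2 : 0 ≤ (q - (n + 2 * k - 16 / 7)) * ((S - t) * n + 8 * S * t) := by
    refine mul_nonneg (by linarith) (add_nonneg (mul_nonneg (by linarith) hn.le) ?_)
    positivity
  nlinarith

theorem mass_bound {n k q S t : ℝ} (hk : 2 ≤ k) (hn : 7 * k ^ 2 ≤ n) (ht0 : 0 ≤ t)
    (htk : t ≤ k) (hS0 : 2 * k + 12 / 7 ≤ S) (hS1 : S ≤ 4 * k + 2)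
    (hq : n + 2 * k - 16 / 7 ≤ q) :
    t * (q + n - 2 * k) * n + 4 * S * ((2 * k + 1) * n - 2 * t * (q + 1 - S) + k * (k - 1))
      < (q - k) * S * n := by
  obtain ⟨a, ha, rfl⟩ : ∃ a, 0 ≤ a ∧ k = 2 + a := ⟨k - 2, by linarith, by ring⟩
  obtain ⟨b, hb, rfl⟩ : ∃ b, 0 ≤ b ∧ n = 7 * (2 + a) ^ 2 + b :=
    ⟨n - 7 * (2 + a) ^ 2, by linarith, by ring⟩
  refine mass_bound_aux (a := 2 * (2 + a) + 12 / 7) (by linarith) ht0 htk (by positivity) hS0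
    (by linarith) hS1 (by linarith) hq ?_ ?_ ?_ <;> ring_nf <;> positivity

theorem mass_bound_pred {n k q S t : ℝ} (hk : 2 ≤ k) (hn : 7 * k ^ 2 ≤ n) (ht0 : 0 ≤ t)
    (htk : t ≤ k - 1) (hS0 : 2 * k - 2 / 7 ≤ S) (hS1 : S ≤ 4 * k + 2)
    (hq : n + 2 * k - 16 / 7 ≤ q) :
    t * (q + n - 2 * (k - 1)) * n
        + 4 * S * ((2 * k + 1) * n - 2 * t * (q + 1 - S) + (k - 1) * ((k - 1) - 1))
      < (q - (k - 1)) * S * n := by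
  obtain ⟨a, ha, rfl⟩ : ∃ a, 0 ≤ a ∧ k = 2 + a := ⟨k - 2, by linarith, by ring⟩
  obtain ⟨b, hb, rfl⟩ : ∃ b, 0 ≤ b ∧ n = 7 * (2 + a) ^ 2 + b :=
    ⟨n - 7 * (2 + a) ^ 2, by linarith, by ring⟩
  refine mass_bound_aux (a := 2 * (2 + a) - 2 / 7) (by linarith) ht0 htk (by positivity) hS0
    (by linarith) hS1 (by linarith) hq ?_ ?_ ?_ <;> ring_nf <;> positivity

/-- A graph with large `Q`-index and no path on `2k+3` vertices has exactly `k` vertices of high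
degree, one of which is adjacent to all vertices except at most one. -/
theorem IsPerron.exists_highDegree {n k : ℕ} (hk : 2 ≤ k) (hn : 7 * k ^ 2 ≤ n)
    {G : SimpleGraph (Fin n)} (hG : ¬ HasPathOn G (2 * k + 3))
    (hq : (n : ℝ) + 2 * k - 2 - 2 / 7 ≤ qIndex G) {x : Fin n → ℝ} {u : Fin n}
    (hx : IsPerron G x u) :
    ∃ H : Finset (Fin n), HighDegree G k H ∧ H.card = k ∧ u ∈ H ∧ n ≤ (nbr G u).card + 2 ∧
      qIndex G < n + 2 * k - 2 / 7 := by
  have hk' : (2 : ℝ) ≤ k := by exact_mod_cast hk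
  have hn' : 7 * (k : ℝ) ^ 2 ≤ n := by exact_mod_cast hn
  have hnk : 14 * (k : ℝ) ≤ n := by nlinarith
  set q := qIndex G with hqdef
  have hS1 : ∑ v, x v ≤ 4 * k + 2 := hx.sum_le hG (by
    rw [Fintype.card_fin]
    linarith)
  have hdu := hx.qIndex_add_one_le
  have hdn : ∀ v, ((nbr G v).card : ℝ) + 1 ≤ n := by
    intro v
    have h : nbr G v ⊆ Finset.univ.erase v := fun w hw => by
      simpa using (mem_nbr.1 hw).ne'
    have h1 := Finset.card_le_card h
    rw [Finset.card_erase_of_mem (Finset.mem_univ v), Finset.card_univ, Fintype.card_fin] at h1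
    have := v.2
    have h2 : (nbr G v).card + 1 ≤ n := by omega
    exact_mod_cast h2
  have hdun := hdn u
  have hrow := hx.mul_le
  set H : Finset (Fin n) := Finset.univ.filter (fun v => n + 2 * k + 2 ≤ 2 * (nbr G v).card)
    with hH
  have hHhigh : HighDegree G k H := fun w hw => by
    rw [Fintype.card_fin]
    simpa [hH] using hw
  have hHdeg : ∀ w ∈ H, (n : ℝ) + 2 * k + 2 ≤ 2 * (nbr G w).card := fun w hw => by
    have h : n + 2 * k + 2 ≤ 2 * (nbr G w).card := by simpa [hH] using hw
    exact_mod_cast h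
  have hRdeg : ∀ w ∉ H, 2 * ((nbr G w).card : ℝ) + 1 ≤ n + 2 * k + 2 := fun w hw => by
    have h : 2 * (nbr G w).card + 1 ≤ n + 2 * k + 2 := by
      simp [hH] at hw
      omega
    exact_mod_cast h
  have hsk := hHhigh.card_le hG
  have huH : u ∈ H := by
    by_contra hu
    have := hRdeg u hu
    nlinarith
  have hform := hx.mul_sum_le H (y := 2 * (∑ v, x v) / n)
  have hE := sum_card_nbr_compl_le hG H
  have hHsum : (∑ v ∈ H, x v) * (q + 1 - ∑ v, x v) ≤ ∑ v ∈ H, ((nbr G v).card : ℝ) := by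
    rw [Finset.sum_mul]
    refine Finset.sum_le_sum fun w hw => hx.mul_le_card_nbr (by nlinarith) ?_
    have := hHdeg w hw
    linarith
  have ht0 : 0 ≤ ∑ v ∈ H, x v := Finset.sum_nonneg fun v _ => hx.nonneg v
  have hts : ∑ v ∈ H, x v ≤ H.card := by
    simpa using Finset.sum_le_card_nsmul H x 1 fun w _ => hx.le_one w
  rw [Fintype.card_fin] at hform hE
  set S := ∑ v, x v with hS
  set t := ∑ v ∈ H, x v with ht
  set e := ∑ v ∈ Hᶜ, ((nbr G v ∩ Hᶜ).card : ℝ) with he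
  have hS0 : 2 * (k : ℝ) - 2 / 7 ≤ S := by linarith
  have hnpos : (0 : ℝ) < n := by linarith
  have hform' : q * S * n ≤ t * (q + n) * n + H.card * (S - 2 * t) * n + 4 * S * e := by
    have h := hform (fun v hv => by
      rw [le_div_iff₀ hnpos]
      have h1 := hRdeg v hv
      have h2 := hrow v
      have h3 := mul_nonneg (show 0 ≤ q + 1 - (nbr G v).card - n / 2 by linarith) (hx.nonneg v)
      linarith)
    have h2 := mul_le_mul_of_nonneg_right h hnpos.le
    have h3 : 2 * (2 * S / n) * e * n = 4 * S * e := by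
      field_simp
      ring
    linarith
  have hkey : q * S * n ≤ t * (q + n) * n + H.card * (S - 2 * t) * n
      + 4 * S * ((2 * k + 1) * n - 2 * t * (q + 1 - S) + H.card * (H.card - 1)) := by
    have h := mul_le_mul_of_nonneg_left
      (show e ≤ (2 * k + 1) * n - 2 * t * (q + 1 - S) + H.card * (H.card - 1) by linarith)
      (show 0 ≤ 4 * S by linarith)
    linarith
  have hcard : H.card = k := by
    by_contra hne
    have h1 : H.card + 1 ≤ k := by omega
    have h2 : (H.card : ℝ) + 1 ≤ k := by exact_mod_cast h1
    have h3 := mass_bound_pred hk' hn' ht0 (by linarith) hS0 hS1 (by linarith : _ ≤ q)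
    have h4 : (H.card : ℝ) * (S - 2 * t) * n ≤ (k - 1) * (S - 2 * t) * n := by
      refine mul_le_mul_of_nonneg_right (mul_le_mul_of_nonneg_right (by linarith) ?_) hnpos.le
      linarith
    have h5 : (1 : ℝ) ≤ H.card := by
      exact_mod_cast Finset.card_pos.2 ⟨u, huH⟩
    have h6 : (H.card : ℝ) * (H.card - 1) ≤ (k - 1) * ((k - 1) - 1) :=
      mul_le_mul (by linarith) (by linarith) (by linarith) (by linarith)
    have h7 := mul_le_mul_of_nonneg_left h6 (show 0 ≤ 4 * S by linarith)
    linarith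
  rw [hcard] at hkey hts
  have hSlt : S < 2 * k + 12 / 7 := by
    by_contra! hc
    have := mass_bound hk' hn' ht0 hts hc hS1 (by linarith : _ ≤ q)
    linarith
  refine ⟨H, hHhigh, hcard, huH, ?_, by linarith⟩
  have h : ((n : ℕ) : ℝ) < ((nbr G u).card + 3 : ℕ) := by
    push_cast
    linarith
  have h' : n < (nbr G u).card + 3 := by exact_mod_cast h
  omega

/-- The end vertices of an edge `cd` whose only other possible neighbour is `u` have small
entries. -/
theorem IsPerron.add_mul_le {V : Type*} [Fintype V] [DecidableEq V] {G : SimpleGraph V}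
    {x : V → ℝ} {u c d : V} (hx : IsPerron G x u) (hc : nbr G c ⊆ {u, d})
    (hd : nbr G d ⊆ {u, c}) : (x c + x d) * (qIndex G - 3) ≤ 2 := by
  have key : ∀ c d, nbr G c ⊆ {u, d} → qIndex G * x c ≤ 2 * x c + (1 + x d) := by
    intro c d h
    have h1 : ((nbr G c).card : ℝ) ≤ 2 := by
      exact_mod_cast (Finset.card_le_card h).trans Finset.card_le_two
    have h2 : ∑ w ∈ nbr G c, x w ≤ 1 + x d := by
      refine (Finset.sum_le_sum_of_subset_of_nonneg h fun i _ _ => hx.nonneg i).trans ?_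
      by_cases hud : u = d
      · subst hud
        simp [hx.eq_one]
      · rw [Finset.sum_pair hud, hx.eq_one]
    rw [hx.eigen c]
    have := mul_le_mul_of_nonneg_right h1 (hx.nonneg c)
    linarith
  have h1 := key c d hc
  have h2 := key d c hd
  linarith

theorem iso_of_not_hasPathOn {n k : ℕ} (hk : 2 ≤ k) (hn : 7 * k ^ 2 ≤ n) {G : SimpleGraph (Fin n)}
    (hG : ¬ HasPathOn G (2 * k + 3)) (hq : qIndex (SnkPlus n k) ≤ qIndex G) :
    Nonempty (G ≃g SnkPlus n k) := by
  have hk' : (2 : ℝ) ≤ k := by exact_mod_cast hk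
  have hn' : 7 * (k : ℝ) ^ 2 ≤ n := by exact_mod_cast hn
  have hnk : 14 * (k : ℝ) ≤ n := by nlinarith
  have hnk2 : k + 2 ≤ n := by nlinarith
  have : Nonempty (Fin n) := ⟨⟨0, by omega⟩⟩
  obtain ⟨x, u, hx⟩ := exists_isPerron G
  have hq0 := (qIndex_SnkPlus_ge hk hn).trans hq
  obtain ⟨H, hH, hHc, hu, hdu, hqlt⟩ := hx.exists_highDegree hk hn hG hq0
  have hnear : ∀ a c, a ∉ H → c ∉ H → a ≠ c → G.Adj u a ∨ G.Adj u c := by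
    intro a c ha hc hac
    by_contra! h
    have h1 : nbr G u ⊆ ((Finset.univ.erase u).erase a).erase c := fun z hz => by
      rw [mem_nbr] at hz
      simp only [Finset.mem_erase, Finset.mem_univ, and_true]
      exact ⟨fun h0 => h.2 (h0 ▸ hz), fun h0 => h.1 (h0 ▸ hz), hz.ne'⟩
    have hau : a ≠ u := fun h0 => ha (h0 ▸ hu)
    have hcu : c ≠ u := fun h0 => hc (h0 ▸ hu)
    have h2 := Finset.card_le_card h1
    rw [Finset.card_erase_of_mem (by simp [hcu, hac.symm]), Finset.card_erase_of_mem (by simp [hau]),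
      Finset.card_erase_of_mem (by simp), Finset.card_univ, Fintype.card_fin] at h2
    omega
  have hmatch : ∀ a b c, a ∉ H → b ∉ H → c ∉ H → G.Adj a b → G.Adj b c → a = c := by
    intro a b c ha hb hc hab hbc
    by_contra hac
    rcases hnear a c ha hc hac with h | h
    · exact hH.not_adj_adj hG hHc hu ha hb hc h hab hac hbc
    · exact hH.not_adj_adj hG hHc hu hc hb ha h hbc.symm (Ne.symm hac) hab.symm
  have hdisj : ∀ a b c d, a ∉ H → b ∉ H → c ∉ H → d ∉ H → G.Adj a b → G.Adj c d →
      ¬ ((c = a ∧ d = b) ∨ (c = b ∧ d = a)) → a ≠ c ∧ a ≠ d ∧ b ≠ c ∧ b ≠ d := by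
    intro a b c d ha hb hc hd hab hcd hne
    refine ⟨?_, ?_, ?_, ?_⟩ <;> rintro rfl
    · exact hne (Or.inl ⟨rfl, hmatch _ _ _ hd ha hb hcd.symm hab⟩)
    · exact hne (Or.inr ⟨hmatch _ _ _ hc ha hb hcd hab, rfl⟩)
    · exact hne (Or.inr ⟨rfl, hmatch _ _ _ hd hb ha hcd.symm hab.symm⟩)
    · exact hne (Or.inl ⟨hmatch _ _ _ hc hb ha hcd hab.symm, rfl⟩)
  by_cases hone : ∀ a ∉ H, ∀ b ∉ H, ∀ c ∉ H, ∀ d ∉ H, G.Adj a b → G.Adj c d →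
      (c = a ∧ d = b) ∨ (c = b ∧ d = a)
  · exact iso_of_edges_outside (by omega) hnk2 hHc hone hq
  exfalso
  simp only [not_forall] at hone
  obtain ⟨a₀, ha₀, b₀, hb₀, c₀, hc₀, d₀, hd₀, hab₀, hcd₀, hne₀⟩ := hone
  obtain ⟨w, hw⟩ : (H.erase u).Nonempty := by
    rw [← Finset.card_pos, Finset.card_erase_of_mem hu]
    omega
  obtain ⟨hwu, hw⟩ := Finset.mem_erase.1 hw
  have hiso : ∀ c d, c ∉ H → d ∉ H → G.Adj c d → ∀ w ∈ H, w ≠ u → ¬ G.Adj w c := by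
    intro c d hc hd hcd w hw hwu
    obtain ⟨a, b, ha, hb, hab, hne⟩ : ∃ a b, a ∉ H ∧ b ∉ H ∧ G.Adj a b ∧
        ¬ ((c = a ∧ d = b) ∨ (c = b ∧ d = a)) := by
      by_cases h : (c = a₀ ∧ d = b₀) ∨ (c = b₀ ∧ d = a₀)
      · refine ⟨c₀, d₀, hc₀, hd₀, hcd₀, fun h' => hne₀ ?_⟩
        rcases h with ⟨rfl, rfl⟩ | ⟨rfl, rfl⟩ <;> rcases h' with ⟨rfl, rfl⟩ | ⟨rfl, rfl⟩ <;> simp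
      · exact ⟨a₀, b₀, ha₀, hb₀, hab₀, h⟩
    obtain ⟨h1, h2, h3, h4⟩ := hdisj a b c d ha hb hc hd hab hcd hne
    rcases hnear a b ha hb hab.ne with h | h
    · exact hH.not_adj_of_disjoint hG hHc hu hw hwu.symm ha hb hc hd h hab hcd h1 h2 h3 h4
    · exact hH.not_adj_of_disjoint hG hHc hu hw hwu.symm hb ha hc hd h hab.symm hcd h3 h4 h1 h2
  have hnbr : ∀ c d, c ∉ H → d ∉ H → G.Adj c d → nbr G c ⊆ {u, d} := by
    intro c d hc hd hcd z hz
    rw [mem_nbr] at hz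
    rw [Finset.mem_insert, Finset.mem_singleton]
    by_cases hzH : z ∈ H
    · by_contra! h
      exact hiso c d hc hd hcd z hzH h.1 hz.symm
    · exact Or.inr (hmatch z c d hzH hc hd hz.symm hcd)
  have hq3 : 0 < qIndex G - 3 := by linarith
  set δ : ℝ := 2 / (qIndex G - 3) with hδ
  have hδ0 : 0 < δ := by positivity
  have hδq : δ * (qIndex G - 3) = 2 := div_mul_cancel₀ _ hq3.ne'
  have hsmall : ∀ c d, c ∉ H → d ∉ H → G.Adj c d → x c + x d ≤ δ := fun c d hc hd hcd => by
    rw [hδ, le_div_iff₀ hq3]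
    exact hx.add_mul_le (hnbr c d hc hd hcd) (hnbr d c hd hc hcd.symm)
  set T := joinPlus H a₀ b₀ with hT
  have hTH : ∀ v h, h ∈ H → v ≠ h → T.Adj v h := fun v h hh hv => ⟨hv, Or.inr (Or.inl hh)⟩
  set Δ : Fin n → ℝ := fun v =>
    ∑ z ∈ nbr T v, (x v + x z) ^ 2 - ∑ z ∈ nbr G v, (x v + x z) ^ 2 with hΔ
  have hΔsum : ∑ v, Δ v ≤ 0 := by
    have h1 := edgeForm_of_eigen hx.eigen
    have h2 := edgeForm_le T x
    have h3 : qIndex T ≤ qIndex G := by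
      obtain ⟨e⟩ := exists_iso_joinPlus hHc ha₀ hb₀ hab₀.ne
      rw [hT, qIndex_eq_of_iso e]
      exact hq
    have h4 := mul_le_mul_of_nonneg_right h3
      (Finset.sum_nonneg fun v (_ : v ∈ Finset.univ) => sq_nonneg (x v))
    have h5 : ∑ v, Δ v = edgeForm T x - edgeForm G x := Finset.sum_sub_distrib _ _
    linarith
  classical
  set E : Finset (Fin n) := Finset.univ.filter (fun v => v ∉ H ∧ ∃ d, d ∉ H ∧ G.Adj v d) with hE
  have hmemE : ∀ v, v ∈ E ↔ v ∉ H ∧ ∃ d, d ∉ H ∧ G.Adj v d := fun v => by simp [hE]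
  have hsub : ∀ v, v ∉ E → nbr G v ⊆ nbr T v := by
    intro v hv z hz
    rw [mem_nbr] at hz ⊢
    by_cases hvH : v ∈ H
    · exact (hTH z v hvH hz.ne').symm
    · by_cases hzH : z ∈ H
      · exact hTH v z hzH hz.ne
      · exact absurd ((hmemE v).2 ⟨hvH, z, hzH, hz⟩) hv
  have hΔ0 : ∀ v, v ∉ E → 0 ≤ Δ v := fun v hv => sub_nonneg.2
    (Finset.sum_le_sum_of_subset_of_nonneg (hsub v hv) fun _ _ _ => sq_nonneg _)
  have hΔext : ∀ v, v ∉ E → ∀ s : Finset (Fin n), s ⊆ nbr T v → Disjoint (nbr G v) s →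
      ∑ z ∈ s, (x v + x z) ^ 2 ≤ Δ v := by
    intro v hv s hs hd
    have := Finset.sum_le_sum_of_subset_of_nonneg (Finset.union_subset (hsub v hv) hs)
      (f := fun z => (x v + x z) ^ 2) fun _ _ _ => sq_nonneg _
    rw [Finset.sum_union hd] at this
    simp only [hΔ]
    linarith
  have hΔE : ∀ v ∈ E, x w ^ 2 - δ ^ 2 ≤ Δ v := by
    intro v hv
    obtain ⟨hvH, d, hd, hvd⟩ := (hmemE v).1 hv
    have hud : u ≠ d := fun h => hd (h ▸ hu)
    have h1 := Finset.sum_le_sum_of_subset_of_nonneg (hnbr v d hvH hd hvd)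
      (f := fun z => (x v + x z) ^ 2) fun _ _ _ => sq_nonneg _
    have h2 : ({u, w} : Finset (Fin n)) ⊆ nbr T v := by
      intro z hz
      rw [Finset.mem_insert, Finset.mem_singleton] at hz
      rw [mem_nbr]
      have hzH : z ∈ H := by
        rcases hz with rfl | rfl
        · exact hu
        · exact hw
      exact hTH v z hzH fun h => hvH (h ▸ hzH)
    have h3 := Finset.sum_le_sum_of_subset_of_nonneg h2
      (f := fun z => (x v + x z) ^ 2) fun _ _ _ => sq_nonneg _
    rw [Finset.sum_pair hud] at h1
    rw [Finset.sum_pair hwu.symm] at h3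
    have h4 := hsmall v d hvH hd hvd
    have h5 := pow_le_pow_left₀ (add_nonneg (hx.nonneg v) (hx.nonneg d)) h4 2
    have h6 := pow_le_pow_left₀ (hx.nonneg w) (show x w ≤ x v + x w by linarith [hx.nonneg v]) 2
    simp only [hΔ]
    linarith
  have hEsum : E.card * (x w ^ 2 - δ ^ 2) ≤ ∑ v ∈ E, Δ v := by
    simpa [nsmul_eq_mul] using Finset.card_nsmul_le_sum E Δ _ hΔE
  have hEc : ∀ v, v ∉ E → Δ v ≤ ∑ z ∈ Eᶜ, Δ z := fun v hv =>
    Finset.single_le_sum (fun z hz => hΔ0 z (Finset.mem_compl.1 hz)) (Finset.mem_compl.2 hv)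
  rw [← Finset.sum_add_sum_compl E] at hΔsum
  have huE : u ∉ E := fun h => ((hmemE u).1 h).1 hu
  have hwE : w ∉ E := fun h => ((hmemE w).1 h).1 hw
  by_cases huw : G.Adj u w
  · have h1 : E.card * x w ^ 2 ≤ Δ w := by
      refine le_trans ?_ (hΔext w hwE E ?_ ?_)
      · rw [← nsmul_eq_mul]
        refine Finset.card_nsmul_le_sum _ _ _ fun z _ => ?_
        exact pow_le_pow_left₀ (hx.nonneg w) (by linarith [hx.nonneg z]) 2
      · intro z hz
        rw [mem_nbr]
        exact (hTH z w hw fun h => hwE (h ▸ hz)).symm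
      · rw [Finset.disjoint_right]
        intro z hz hz'
        obtain ⟨hzH, d, hd, hzd⟩ := (hmemE z).1 hz
        exact hiso z d hzH hd hzd w hw hwu (mem_nbr.1 hz')
    have h2 := hEc w hwE
    have h3 : 1 ≤ (qIndex G - (nbr G w).card) * x w := by
      have h4 := hx.eigen w
      have h5 := Finset.single_le_sum (f := x) (fun i _ => hx.nonneg i) (mem_nbr.2 huw.symm)
      rw [hx.eq_one] at h5
      linarith
    have h4 : (n : ℝ) + 2 * k + 2 ≤ 2 * (nbr G w).card := by
      have := hH w hw
      rw [Fintype.card_fin] at this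
      exact_mod_cast this
    have h5 : 3 * δ ≤ 4 * x w := by
      have h6 := mul_le_mul_of_nonneg_right (show 3 * (qIndex G - (nbr G w).card)
        ≤ 2 * (qIndex G - 3) by linarith) (hx.nonneg w)
      refine le_of_mul_le_mul_right ?_ hq3
      linarith
    have h6 : 0 < (E.card : ℝ) := by
      exact_mod_cast Finset.card_pos.2 ⟨a₀, (hmemE a₀).2 ⟨ha₀, b₀, hb₀, hab₀⟩⟩
    have h7 : 0 < 2 * x w ^ 2 - δ ^ 2 := by nlinarith
    nlinarith
  · have h1 : 1 ≤ Δ u := by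
      refine le_trans ?_ (hΔext u huE {w} ?_ ?_)
      · rw [Finset.sum_singleton, hx.eq_one]
        nlinarith [hx.nonneg w]
      · simpa using hTH u w hw hwu.symm
      · simpa using huw
    have h2 := hEc u huE
    have h3 : (E.card : ℝ) ≤ n := by
      have := Finset.card_le_univ E
      rw [Fintype.card_fin] at this
      exact_mod_cast this
    have h4 : n * δ ^ 2 < 1 := by
      have h5 : 4 * (n : ℝ) < (qIndex G - 3) ^ 2 := by nlinarith
      have h6 : (qIndex G - 3) ^ 2 * (n * δ ^ 2) = 4 * n := by
        linear_combination (n : ℝ) * (δ * (qIndex G - 3) + 2) * hδq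
      refine lt_of_mul_lt_mul_left ?_ (sq_nonneg (qIndex G - 3))
      linarith
    have h5 := mul_le_mul_of_nonneg_right h3 (sq_nonneg δ)
    have h6 : 0 ≤ E.card * x w ^ 2 := by positivity
    linarith

/-- Nikiforov–Yuan, Theorem 4(ii): if `k ≥ 1`, `n ≥ 7k²` and `q(G) ≥ q(S_{n,k}^+)`,
then `P_{2k+3} ⊆ G` unless `G ≅ S_{n,k}^+`. -/
theorem stmt_1 (k n : ℕ) (hk : 1 ≤ k) (hn : 7 * k ^ 2 ≤ n) (G : SimpleGraph (Fin n))
    (hq : qIndex (SnkPlus n k) ≤ qIndex G) :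
    HasPathOn G (2 * k + 3) ∨ Nonempty (G ≃g SnkPlus n k) := by
  by_contra! hc
  rcases hk.eq_or_lt with rfl | hk
  · obtain ⟨e⟩ := iso_of_not_hasPathOn_one (by omega) hc.1 hq
    exact hc.2.false e
  · obtain ⟨e⟩ := iso_of_not_hasPathOn hk hn hc.1 hq
    exact hc.2.false e
end
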